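/- arXiv:1504.06071 — 6 statements merged into one kernel-verified Lean document; each statement's English description precedes it below -/
import Mathlib

section
/- Let q be a power of an odd prime and let A = 𝔽_q[T]. For every integer n ≥ 2, SLₙ(A) is a polynomial family with 45 + n(3n+1)/2 parameters: there exist n² polynomials P_{ij} (1 ≤ i, j ≤ n) in 45 + n(3n+1)/2 variables with coefficients in A such that the set of matrices (P_{ij}(x)), as x ranges over A^{45 + n(3n+1)/2}, is exactly the set of n × n matrices over A with determinant 1. -/
open Polynomial

namespace FqT

section Monics

variable {F : Type*} [Field F] [Fintype F]

theorem finite_monics (n : ℕ) : {f : F[X] | f.Monic ∧ f.natDegree = n}.Finite := by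
  have : Finite (degreeLT F (n + 1)) := Module.finite_of_finite F
  refine (Set.toFinite (degreeLT F (n + 1) : Set F[X])).subset ?_
  rintro f ⟨-, hf⟩
  rw [SetLike.mem_coe, mem_degreeLT]
  refine lt_of_le_of_lt degree_le_natDegree ?_
  rw [hf]
  exact_mod_cast Nat.lt_succ_self n

variable (F) in
/-- The finite set of monic polynomials of degree `n`. -/
noncomputable def monics (n : ℕ) : Finset F[X] := (finite_monics (F := F) n).toFinset

theorem mem_monics {n : ℕ} {f : F[X]} : f ∈ monics F n ↔ f.Monic ∧ f.natDegree = n := by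
  simp [monics]

open Classical in
variable (F) in
/-- The finite set of monic irreducible polynomials of degree `n`. -/
noncomputable def primes (n : ℕ) : Finset F[X] := (monics F n).filter Irreducible

theorem mem_primes {n : ℕ} {f : F[X]} :
    f ∈ primes F n ↔ (f.Monic ∧ f.natDegree = n) ∧ Irreducible f := by
  simp [primes, mem_monics]

theorem card_monics (n : ℕ) : (monics F n).card = Fintype.card F ^ n := by
  classical
  have : Nat.card {f : F[X] | f.Monic ∧ f.natDegree = n} = Nat.card (degreeLT F n) := by
    refine Nat.card_congr ⟨fun f => ⟨f.1 - X ^ n, ?_⟩, fun g => ⟨X ^ n + g.1, ?_⟩, ?_, ?_⟩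
    · rw [mem_degreeLT]
      rcases f with ⟨f, hf, hd⟩
      have hdeg : f.degree = n := by rw [degree_eq_natDegree hf.ne_zero, hd]
      have := degree_sub_lt_left (p := f) (q := X ^ n) (by rw [hdeg, degree_X_pow]) hf.ne_zero
        (by rw [hf.leadingCoeff, leadingCoeff_X_pow])
      rwa [hdeg] at this
    · have hg := mem_degreeLT.1 g.2
      refine ⟨monic_X_pow_add hg, ?_⟩
      rw [natDegree_add_eq_left_of_degree_lt, natDegree_X_pow]
      rwa [degree_X_pow]
    · intro f; ext; simp
    · intro f; ext; simp
  have h2 : (monics F n).card = Nat.card {f : F[X] | f.Monic ∧ f.natDegree = n} := by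
    rw [Nat.card_coe_set_eq, Set.ncard_eq_toFinset_card _ (finite_monics n)]; rfl
  rw [h2, this, Nat.card_congr (degreeLTEquiv F n).toEquiv]
  simp

theorem card_primes_le (n : ℕ) : (primes F n).card ≤ Fintype.card F ^ n := by
  classical
  rw [← card_monics]
  exact Finset.card_filter_le _ _

/-- The sum of `χ` over the monic polynomials of degree `n`. -/
noncomputable def monicSum (χ : F[X] →* ℂ) (n : ℕ) : ℂ := ∑ f ∈ monics F n, χ f

/-- The sum of `Λ χ` over the monic polynomials of degree `n`, where `Λ` is the
von Mangoldt function. -/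
noncomputable def primeSum (χ : F[X] →* ℂ) (n : ℕ) : ℂ :=
  ∑ m ∈ n.divisors, (m : ℂ) * ∑ π ∈ primes F m, χ π ^ (n / m)

open Classical in
theorem sum_monics_pow_dvd (χ : F[X] →* ℂ) {n m k : ℕ} {π : F[X]} (hπ : π ∈ primes F m) :
    ∑ f ∈ (monics F n).filter (π ^ k ∣ ·), χ f =
      if k * m ≤ n then χ π ^ k * monicSum χ (n - k * m) else 0 := by
  obtain ⟨⟨hm, hd⟩, -⟩ := mem_primes.1 hπ
  have hpm : (π ^ k).Monic := hm.pow k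
  have hpd : (π ^ k).natDegree = k * m := by rw [hm.natDegree_pow, hd]
  split_ifs with h
  · rw [monicSum, Finset.mul_sum]
    symm
    refine Finset.sum_bij (fun g _ => π ^ k * g) ?_ ?_ ?_ ?_
    · intro g hg
      obtain ⟨hgm, hgd⟩ := mem_monics.1 hg
      rw [Finset.mem_filter, mem_monics]
      refine ⟨⟨hpm.mul hgm, ?_⟩, dvd_mul_right _ _⟩
      rw [hpm.natDegree_mul hgm, hpd, hgd]; omega
    · intro g _ g' _ h
      exact mul_left_cancel₀ hpm.ne_zero h
    · intro f hf
      rw [Finset.mem_filter, mem_monics] at hf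
      obtain ⟨⟨hfm, hfd⟩, g, rfl⟩ := hf
      have hgm := hpm.of_mul_monic_left hfm
      refine ⟨g, mem_monics.2 ⟨hgm, ?_⟩, rfl⟩
      rw [hpm.natDegree_mul hgm, hpd] at hfd; omega
    · intro g _; simp
  · rw [Finset.filter_false_of_mem, Finset.sum_empty]
    intro f hf hdvd
    obtain ⟨hfm, hfd⟩ := mem_monics.1 hf
    have := natDegree_le_of_dvd hdvd hfm.ne_zero
    omega

open Classical in
theorem natDegree_eq_sum_pow_dvd {n : ℕ} {f : F[X]} (hf : f ∈ monics F n) :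
    n = ∑ m ∈ Finset.Icc 1 n, ∑ π ∈ primes F m,
      m * ((Finset.Icc 1 n).filter (fun k => π ^ k ∣ f)).card := by
  obtain ⟨hfm, hfd⟩ := mem_monics.1 hf
  have hf0 := hfm.ne_zero
  set s := UniqueFactorizationMonoid.normalizedFactors f with hs
  have hprod : s.prod = f := by
    rw [UniqueFactorizationMonoid.prod_normalizedFactors_eq hf0, hfm.normalize_eq_self]
  have hirr : ∀ π ∈ s, Irreducible π := fun π h =>
    UniqueFactorizationMonoid.irreducible_of_normalized_factor π h
  have hmon : ∀ π ∈ s, π.Monic := fun π h => by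
    rw [← UniqueFactorizationMonoid.normalize_normalized_factor π h]
    exact monic_normalize (hirr π h).ne_zero
  have hle : ∀ π ∈ s, π.natDegree ≤ n := fun π h => hfd ▸
    natDegree_le_of_dvd (UniqueFactorizationMonoid.dvd_of_mem_normalizedFactors h) hf0
  have hcount : ∀ m ∈ Finset.Icc 1 n, ∀ π ∈ primes F m,
      ((Finset.Icc 1 n).filter (fun k => π ^ k ∣ f)).card = s.count π := by
    intro m hm π hπ
    obtain ⟨⟨hπm, hπd⟩, hπi⟩ := mem_primes.1 hπ
    have hdvd : ∀ k, π ^ k ∣ f ↔ k ≤ s.count π := by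
      intro k
      rw [pow_dvd_iff_le_emultiplicity,
        UniqueFactorizationMonoid.emultiplicity_eq_count_normalizedFactors hπi hf0,
        hπm.normalize_eq_self]
      exact_mod_cast Iff.rfl
    have hcn : s.count π ≤ n := by
      have h1 := natDegree_le_of_dvd ((hdvd _).2 le_rfl) hf0
      rw [hπm.natDegree_pow, hπd, hfd] at h1
      have := (Finset.mem_Icc.1 hm).1
      nlinarith
    have : (Finset.Icc 1 n).filter (fun k => π ^ k ∣ f) = Finset.Icc 1 (s.count π) := by
      ext k
      simp only [Finset.mem_filter, Finset.mem_Icc, hdvd]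
      omega
    rw [this]; simp
  have h1 : n = ∑ π ∈ s.toFinset, s.count π * π.natDegree := by
    conv_lhs => rw [← hfd, ← hprod, natDegree_multiset_prod _ (fun h => (hirr 0 h).ne_zero rfl)]
    rw [Finset.sum_multiset_map_count]; simp
  have h2 : ∑ π ∈ s.toFinset, s.count π * π.natDegree =
      ∑ π ∈ (Finset.Icc 1 n).biUnion (primes F), s.count π * π.natDegree := by
    refine Finset.sum_subset ?_ ?_
    · intro π hπ
      rw [Multiset.mem_toFinset] at hπ
      refine Finset.mem_biUnion.2 ⟨π.natDegree, Finset.mem_Icc.2 ⟨?_, hle π hπ⟩,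
        mem_primes.2 ⟨⟨hmon π hπ, rfl⟩, hirr π hπ⟩⟩
      exact (hirr π hπ).natDegree_pos
    · intro π _ hπ
      rw [Multiset.mem_toFinset] at hπ
      simp [Multiset.count_eq_zero.2 hπ]
  conv_lhs => rw [h1, h2]
  rw [Finset.sum_biUnion]
  · refine Finset.sum_congr rfl fun m hm => Finset.sum_congr rfl fun π hπ => ?_
    rw [hcount m hm π hπ, (mem_primes.1 hπ).1.2, mul_comm]
  · intro m _ m' _ hmm
    rw [Function.onFun, Finset.disjoint_left]
    intro π h h'
    exact hmm ((mem_primes.1 h).1.2.symm.trans (mem_primes.1 h').1.2)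

theorem natCast_mul_monicSum (χ : F[X] →* ℂ) (n : ℕ) :
    (n : ℂ) * monicSum χ n =
      ∑ x ∈ Finset.HasAntidiagonal.antidiagonal n, primeSum χ x.1 * monicSum χ x.2 := by
  classical
  have h1 : (n : ℂ) * monicSum χ n = ∑ m ∈ Finset.Icc 1 n, ∑ π ∈ primes F m,
      ∑ k ∈ Finset.Icc 1 n, (m : ℂ) * ∑ f ∈ (monics F n).filter (π ^ k ∣ ·), χ f := by
    rw [monicSum, Finset.mul_sum]
    have : ∀ f ∈ monics F n, (n : ℂ) * χ f = ∑ m ∈ Finset.Icc 1 n, ∑ π ∈ primes F m,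
        ∑ k ∈ Finset.Icc 1 n, (m : ℂ) * if π ^ k ∣ f then χ f else 0 := by
      intro f hf
      conv_lhs => rw [natDegree_eq_sum_pow_dvd hf]
      push_cast
      rw [Finset.sum_mul]
      refine Finset.sum_congr rfl fun m _ => ?_
      rw [Finset.sum_mul]
      refine Finset.sum_congr rfl fun π _ => ?_
      rw [← Finset.mul_sum, ← Finset.sum_filter, Finset.sum_const, nsmul_eq_mul, mul_assoc]
    rw [Finset.sum_congr rfl this, Finset.sum_comm]
    refine Finset.sum_congr rfl fun m _ => ?_
    rw [Finset.sum_comm]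
    refine Finset.sum_congr rfl fun π _ => ?_
    rw [Finset.sum_comm]
    refine Finset.sum_congr rfl fun k _ => ?_
    rw [← Finset.mul_sum, Finset.sum_filter]
  rw [h1, Finset.Nat.sum_antidiagonal_eq_sum_range_succ_mk]
  have h2 : ∀ m ∈ Finset.Icc 1 n, ∑ π ∈ primes F m,
      ∑ k ∈ Finset.Icc 1 n, (m : ℂ) * ∑ f ∈ (monics F n).filter (π ^ k ∣ ·), χ f =
      ∑ k ∈ (Finset.Icc 1 n).filter (fun k => k * m ≤ n),
        (m : ℂ) * ((∑ π ∈ primes F m, χ π ^ k) * monicSum χ (n - k * m)) := by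
    intro m _
    rw [Finset.sum_comm, Finset.sum_filter]
    refine Finset.sum_congr rfl fun k _ => ?_
    rw [← Finset.mul_sum, Finset.sum_congr rfl fun π hπ => sum_monics_pow_dvd χ hπ]
    split_ifs
    · rw [Finset.sum_mul]
    · simp
  rw [Finset.sum_congr rfl h2]
  simp only [primeSum, Finset.sum_mul]
  rw [Finset.sum_sigma', Finset.sum_sigma']
  refine Finset.sum_bij' (fun x _ => ⟨x.2 * x.1, x.1⟩) (fun x _ => ⟨x.2, x.1 / x.2⟩) ?_ ?_ ?_ ?_ ?_
  · rintro ⟨m, k⟩ h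
    simp only [Finset.mem_sigma, Finset.mem_Icc, Finset.mem_filter, Finset.mem_range,
      Nat.mem_divisors] at h ⊢
    exact ⟨by omega, dvd_mul_left _ _, Nat.mul_ne_zero (by omega) (by omega)⟩
  · rintro ⟨i, m⟩ h
    simp only [Finset.mem_sigma, Finset.mem_Icc, Finset.mem_filter, Finset.mem_range,
      Nat.mem_divisors] at h ⊢
    obtain ⟨hi, ⟨k, rfl⟩, h0⟩ := h
    have hm : 0 < m := Nat.pos_of_ne_zero (left_ne_zero_of_mul h0)
    have hk : 0 < k := Nat.pos_of_ne_zero (right_ne_zero_of_mul h0)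
    rw [Nat.mul_div_cancel_left _ hm]
    refine ⟨⟨hm, ?_⟩, ⟨hk, ?_⟩, ?_⟩ <;> nlinarith
  · rintro ⟨m, k⟩ h
    simp only [Finset.mem_sigma, Finset.mem_Icc] at h
    simp [Nat.mul_div_cancel _ (show 0 < m by omega)]
  · rintro ⟨i, m⟩ h
    simp only [Finset.mem_sigma, Nat.mem_divisors] at h
    simp [Nat.div_mul_cancel h.2.1]
  · rintro ⟨m, k⟩ h
    simp only [Finset.mem_sigma, Finset.mem_Icc] at h
    simp only
    rw [Nat.mul_div_cancel _ (show 0 < m by omega), mul_assoc, Finset.sum_mul]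

end Monics

section LogDeriv

open PowerSeries in
/-- `R` is the logarithmic derivative of `Z` with respect to the Euler operator `X d/dX`. -/
def IsLogDeriv (Z R : PowerSeries ℂ) : Prop :=
  PowerSeries.X * PowerSeries.derivative ℂ Z = R * Z

theorem IsLogDeriv.mul {Z R Z' R' : PowerSeries ℂ} (h : IsLogDeriv Z R) (h' : IsLogDeriv Z' R') :
    IsLogDeriv (Z * Z') (R + R') := by
  unfold IsLogDeriv at *
  rw [Derivation.leibniz, smul_eq_mul, smul_eq_mul]
  linear_combination Z' * h + Z * h'

theorem IsLogDeriv.prod {ι : Type*} (s : Finset ι) {Z R : ι → PowerSeries ℂ}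
    (h : ∀ i ∈ s, IsLogDeriv (Z i) (R i)) : IsLogDeriv (∏ i ∈ s, Z i) (∑ i ∈ s, R i) := by
  classical
  induction s using Finset.induction_on with
  | empty => simp [IsLogDeriv]
  | insert i s hi ih =>
    rw [Finset.prod_insert hi, Finset.sum_insert hi]
    exact (h i (Finset.mem_insert_self i s)).mul
      (ih fun j hj => h j (Finset.mem_insert_of_mem hj))

theorem coeff_X_mul_derivative (Z : PowerSeries ℂ) (n : ℕ) :
    PowerSeries.coeff n (PowerSeries.X * PowerSeries.derivative ℂ Z) =
      n * PowerSeries.coeff n Z := by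
  cases n with
  | zero => simp
  | succ n => rw [PowerSeries.coeff_succ_X_mul, PowerSeries.coeff_derivative]; push_cast; ring

theorem rescale_X_mul_derivative (z : ℂ) (Z : PowerSeries ℂ) :
    PowerSeries.rescale z (PowerSeries.X * PowerSeries.derivative ℂ Z) =
      PowerSeries.X * PowerSeries.derivative ℂ (PowerSeries.rescale z Z) := by
  ext n
  rw [PowerSeries.coeff_rescale, coeff_X_mul_derivative, coeff_X_mul_derivative,
    PowerSeries.coeff_rescale]
  ring

theorem IsLogDeriv.rescale {Z R : PowerSeries ℂ} (h : IsLogDeriv Z R) (z : ℂ) :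
    IsLogDeriv (PowerSeries.rescale z Z) (PowerSeries.rescale z R) := by
  unfold IsLogDeriv at *
  rw [← rescale_X_mul_derivative, h, map_mul]

theorem IsLogDeriv.natCast_mul_coeff {Z R : PowerSeries ℂ} (h : IsLogDeriv Z R) (n : ℕ) :
    (n : ℂ) * PowerSeries.coeff n Z = ∑ x ∈ Finset.HasAntidiagonal.antidiagonal n,
      PowerSeries.coeff x.1 R * PowerSeries.coeff x.2 Z := by
  rw [← coeff_X_mul_derivative, h, PowerSeries.coeff_mul]

open ComplexOrder in
theorem IsLogDeriv.coeff_nonneg {Z R : PowerSeries ℂ} (h : IsLogDeriv Z R)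
    (h0 : PowerSeries.coeff 0 Z = 1) (hR : ∀ n, 0 ≤ PowerSeries.coeff n R) (n : ℕ) :
    0 ≤ PowerSeries.coeff n Z := by
  induction n using Nat.strong_induction_on with
  | _ n ih =>
    rcases Nat.eq_zero_or_pos n with rfl | hn
    · rw [h0]; exact zero_le_one
    have hR0 : PowerSeries.coeff 0 R = 0 := by
      have := h.natCast_mul_coeff 0
      simpa [h0] using this.symm
    have key : 0 ≤ (n : ℂ) * PowerSeries.coeff n Z := by
      rw [h.natCast_mul_coeff]
      refine Finset.sum_nonneg fun x hx => ?_
      rcases Nat.eq_zero_or_pos x.1 with h1 | h1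
      · rw [h1, hR0, zero_mul]
      · rw [Finset.HasAntidiagonal.mem_antidiagonal] at hx
        exact mul_nonneg (hR _) (ih _ (by omega))
    have hn0 : (n : ℂ) ≠ 0 := by exact_mod_cast hn.ne'
    have hinv : (0 : ℂ) ≤ (n : ℂ)⁻¹ := by
      rw [← Complex.ofReal_natCast, ← Complex.ofReal_inv, Complex.zero_le_real]
      positivity
    simpa [hn0] using mul_nonneg hinv key

open ComplexOrder in
theorem IsLogDeriv.coeff_ne_zero {Z R : PowerSeries ℂ} (h : IsLogDeriv Z R)
    (h0 : PowerSeries.coeff 0 Z = 1) (hR : ∀ n, 0 ≤ PowerSeries.coeff n R) {n : ℕ}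
    (hn : PowerSeries.coeff n R ≠ 0) : PowerSeries.coeff n Z ≠ 0 := by
  intro hz
  have h1 := h.natCast_mul_coeff n
  rw [hz, mul_zero] at h1
  have h2 := (Finset.sum_eq_zero_iff_of_nonneg
    (fun x _ => mul_nonneg (hR x.1) (h.coeff_nonneg h0 hR x.2))).1 h1.symm (n, 0)
    (by simp)
  simp only [h0, mul_one] at h2
  exact hn h2

end LogDeriv

section Abstract

/-- The subring of power series that are polynomials. -/
noncomputable def polySubring : Subring (PowerSeries ℂ) :=
  (Polynomial.coeToPowerSeries.ringHom (R := ℂ)).range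

theorem mem_polySubring {f : PowerSeries ℂ} :
    f ∈ polySubring ↔ ∃ p : ℂ[X], (p : PowerSeries ℂ) = f := Iff.rfl

theorem rescale_coe (z : ℂ) (p : ℂ[X]) :
    PowerSeries.rescale z (p : PowerSeries ℂ) = (p.comp (C z * X) : ℂ[X]) := by
  ext n
  rw [PowerSeries.coeff_rescale, Polynomial.coeff_coe, Polynomial.coeff_coe, comp_C_mul_X_coeff,
    mul_comm]

theorem coe_linear (q : ℂ) : ((1 - C q * X : ℂ[X]) : PowerSeries ℂ) =
    1 - PowerSeries.C q * PowerSeries.X := by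
  simp

/-- Finitely many L-series, all but one polynomial, and one with a simple pole at `q⁻¹`. -/
structure LSystem (I : Type*) (i₀ : I) (q : ℂ) where
  L : I → PowerSeries ℂ
  Ψ : I → PowerSeries ℂ
  P : I → ℂ[X]
  logDeriv : ∀ i, IsLogDeriv (L i) (Ψ i)
  coeff_zero : ∀ i, PowerSeries.coeff 0 (L i) = 1
  eq_of_ne : ∀ i, i ≠ i₀ → L i = P i
  mul_eq : L i₀ * (1 - C q * X : ℂ[X]) = P i₀

variable {I : Type*} {i₀ : I} {q : ℂ} (S : LSystem I i₀ q)

theorem LSystem.pole_identity : S.Ψ i₀ * ((1 - C q * X) * S.P i₀ : ℂ[X]) =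
    (C q * X * S.P i₀ + (1 - C q * X) * (X * derivative (S.P i₀)) : ℂ[X]) := by
  have h1 := S.logDeriv i₀
  unfold IsLogDeriv at h1
  have h2 := S.mul_eq
  have h3 := congrArg (fun f => PowerSeries.X * PowerSeries.derivative ℂ f) h2
  simp only [PowerSeries.derivative_coe, Derivation.leibniz, smul_eq_mul] at h3
  simp only [derivative_sub, derivative_one, derivative_mul, derivative_C, derivative_X] at h3
  push_cast at h2 h3 ⊢
  rw [← h2]
  linear_combination (1 - PowerSeries.C q * PowerSeries.X) * h3 -
    (1 - PowerSeries.C q * PowerSeries.X) ^ 2 * h1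

variable [Fintype I] (N : ℕ) [Fintype (rootsOfUnity N ℂ)]

theorem LSystem.prod_mul : (∏ i, S.L i) * (1 - C q * X : ℂ[X]) = (∏ i, S.P i : ℂ[X]) := by
  classical
  have : ((∏ i, S.P i : ℂ[X]) : PowerSeries ℂ) = ∏ i, (S.P i : PowerSeries ℂ) :=
    map_prod (Polynomial.coeToPowerSeries.ringHom (R := ℂ)) _ _
  rw [this, ← Finset.mul_prod_erase _ _ (Finset.mem_univ i₀),
    ← Finset.mul_prod_erase _ _ (Finset.mem_univ i₀), ← S.mul_eq, mul_right_comm]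
  congr 1
  refine Finset.prod_congr rfl fun i hi => S.eq_of_ne i (Finset.ne_of_mem_erase hi)

open ComplexOrder in
theorem LSystem.eval_ne_zero (hq : q ≠ 0)
    (hpos : ∀ n, 0 ≤ ∑ z : rootsOfUnity N ℂ, ∑ i,
      ((z : ℂˣ) : ℂ) ^ n * PowerSeries.coeff n (S.Ψ i))
    (hinf : ∀ B, ∃ n > B, ∑ z : rootsOfUnity N ℂ, ∑ i,
      ((z : ℂˣ) : ℂ) ^ n * PowerSeries.coeff n (S.Ψ i) ≠ 0)
    (i : I) (z₀ : rootsOfUnity N ℂ) : (S.P i).eval (((z₀ : ℂˣ) : ℂ) * q⁻¹) ≠ 0 := by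
  classical
  intro hzero
  set w : ℂ := ((z₀ : ℂˣ) : ℂ) with hw
  have hw0 : w ≠ 0 := (z₀ : ℂˣ).ne_zero
  set Y := ∏ i, S.L i with hY
  set U := ∏ i, S.P i with hU
  have hUz : U.IsRoot (w * q⁻¹) := by
    rw [IsRoot, hU, eval_prod]
    exact Finset.prod_eq_zero (Finset.mem_univ i) hzero
  obtain ⟨V', hV'⟩ := dvd_iff_isRoot.2 hUz
  set V : ℂ[X] := C (-(w * q⁻¹)) * V' with hV
  have hUV : U = (1 - C (q * w⁻¹) * X) * V := by
    have h1 : C (q * w⁻¹) * C (w * q⁻¹) = (1 : ℂ[X]) := by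
      rw [← C_mul, ← C_1]; congr 1; field_simp
    rw [hV', hV, C_neg]
    linear_combination (-X * V') * h1
  set Z : PowerSeries ℂ := ∏ z : rootsOfUnity N ℂ, PowerSeries.rescale ((z : ℂˣ) : ℂ) Y with hZ
  have hlog : IsLogDeriv Z
      (∑ z : rootsOfUnity N ℂ, PowerSeries.rescale ((z : ℂˣ) : ℂ) (∑ i, S.Ψ i)) :=
    IsLogDeriv.prod _ fun z _ => (IsLogDeriv.prod _ fun i _ => S.logDeriv i).rescale _
  have hcoeff : ∀ n, PowerSeries.coeff n
      (∑ z : rootsOfUnity N ℂ, PowerSeries.rescale ((z : ℂˣ) : ℂ) (∑ i, S.Ψ i)) =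
      ∑ z : rootsOfUnity N ℂ, ∑ i, ((z : ℂˣ) : ℂ) ^ n * PowerSeries.coeff n (S.Ψ i) := by
    intro n
    simp [PowerSeries.coeff_rescale]
  have hZ0 : PowerSeries.coeff 0 Z = 1 := by
    simp only [PowerSeries.coeff_zero_eq_constantCoeff] at *
    rw [hZ, map_prod]
    refine Finset.prod_eq_one fun z _ => ?_
    rw [← PowerSeries.coeff_zero_eq_constantCoeff_apply, PowerSeries.coeff_rescale, pow_zero,
      one_mul, PowerSeries.coeff_zero_eq_constantCoeff_apply, hY, map_prod]
    refine Finset.prod_eq_one fun i _ => ?_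
    rw [← PowerSeries.coeff_zero_eq_constantCoeff_apply, S.coeff_zero]
  set D : PowerSeries ℂ := ∏ z : rootsOfUnity N ℂ,
    PowerSeries.rescale ((z : ℂˣ) : ℂ) ((1 - C q * X : ℂ[X]) : PowerSeries ℂ) with hD
  have hD0 : D ≠ 0 := by
    rw [hD, Finset.prod_ne_zero_iff]
    intro z _ h
    have := congrArg (PowerSeries.coeff 0) h
    rw [PowerSeries.coeff_rescale] at this
    simp at this
  have hshift : PowerSeries.rescale w (U : PowerSeries ℂ) =
      ((1 - C q * X : ℂ[X]) : PowerSeries ℂ) * PowerSeries.rescale w (V : PowerSeries ℂ) := by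
    rw [hUV, Polynomial.coe_mul, map_mul]
    congr 1
    rw [rescale_coe]
    congr 1
    simp only [sub_comp, one_comp, mul_comp, C_comp, X_comp, ← mul_assoc, ← C_mul]
    rw [inv_mul_cancel_right₀ hw0]
  have hZD : Z * D = (∏ z : rootsOfUnity N ℂ, PowerSeries.rescale ((z : ℂˣ) : ℂ)
      (PowerSeries.rescale w (V : PowerSeries ℂ))) * D := by
    rw [hZ, hD, ← Finset.prod_mul_distrib, ← Finset.prod_mul_distrib]
    simp only [← map_mul]
    rw [hY, S.prod_mul, ← hU, mul_comm, ← hshift]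
    simp only [PowerSeries.rescale_rescale]
    rw [← Equiv.prod_comp (Equiv.mulLeft z₀)]
    refine Finset.prod_congr rfl fun z _ => ?_
    simp [hw]
  have hZpoly : Z ∈ polySubring := by
    rw [mul_right_cancel₀ hD0 hZD]
    refine Subring.prod_mem _ fun z _ => ?_
    rw [rescale_coe, rescale_coe]
    exact mem_polySubring.2 ⟨_, rfl⟩
  obtain ⟨p, hp⟩ := mem_polySubring.1 hZpoly
  obtain ⟨n, hn, hne⟩ := hinf p.natDegree
  refine hlog.coeff_ne_zero hZ0 (fun n => by rw [hcoeff]; exact hpos n)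
    (n := n) (by rwa [hcoeff]) ?_
  rw [← hp, Polynomial.coeff_coe]
  exact coeff_eq_zero_of_natDegree_lt hn

/-- The power series `f` is a rational function that is regular at `r`. -/
def RegularAt (r : ℂ) (f : PowerSeries ℂ) : Prop :=
  ∃ D M : ℂ[X], D.eval r ≠ 0 ∧ f * D = M

theorem RegularAt.add {r : ℂ} {f g : PowerSeries ℂ} (hf : RegularAt r f) (hg : RegularAt r g) :
    RegularAt r (f + g) := by
  obtain ⟨D, M, hD, h⟩ := hf
  obtain ⟨D', M', hD', h'⟩ := hg
  refine ⟨D * D', M * D' + M' * D, by simp [hD, hD'], ?_⟩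
  push_cast
  linear_combination (D' : PowerSeries ℂ) * h + (D : PowerSeries ℂ) * h'

theorem RegularAt.C_mul {r : ℂ} {f : PowerSeries ℂ} (hf : RegularAt r f) (c : ℂ) :
    RegularAt r (PowerSeries.C c * f) := by
  obtain ⟨D, M, hD, h⟩ := hf
  refine ⟨D, C c * M, hD, ?_⟩
  push_cast
  linear_combination (PowerSeries.C c) * h

theorem RegularAt.sum {ι : Type*} (s : Finset ι) {r : ℂ} {f : ι → PowerSeries ℂ}
    (h : ∀ i ∈ s, RegularAt r (f i)) : RegularAt r (∑ i ∈ s, f i) := by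
  classical
  induction s using Finset.induction_on with
  | empty => exact ⟨1, 0, by simp, by simp⟩
  | insert i s hi ih =>
    rw [Finset.sum_insert hi]
    exact (h i (Finset.mem_insert_self i s)).add
      (ih fun j hj => h j (Finset.mem_insert_of_mem hj))

theorem summable_coe (r : ℂ) (p : ℂ[X]) :
    Summable fun n => ‖p.coeff n * r ^ n‖ := by
  refine summable_of_ne_finset_zero (s := Finset.range (p.natDegree + 1)) fun n hn => ?_
  rw [coeff_eq_zero_of_natDegree_lt (by simpa using hn)]
  simp

theorem tsum_coe (r : ℂ) (p : ℂ[X]) : ∑' n, p.coeff n * r ^ n = p.eval r := by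
  rw [eval_eq_sum_range, tsum_eq_sum]
  intro n hn
  rw [coeff_eq_zero_of_natDegree_lt (by simpa using hn)]
  simp

theorem eval_eq_zero_of_summable {r : ℂ} {f : PowerSeries ℂ} {D M : ℂ[X]}
    (hs : Summable fun n => ‖PowerSeries.coeff n f * r ^ n‖) (h : f * D = M)
    (hD : D.eval r = 0) : M.eval r = 0 := by
  have key := tsum_mul_tsum_eq_tsum_sum_antidiagonal_of_summable_norm hs (summable_coe r D)
  rw [tsum_coe, hD, mul_zero] at key
  rw [← tsum_coe, key]
  refine tsum_congr fun n => ?_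
  rw [← Polynomial.coeff_coe, ← h, PowerSeries.coeff_mul, Finset.sum_mul]
  refine Finset.sum_congr rfl fun x hx => ?_
  rw [Finset.HasAntidiagonal.mem_antidiagonal] at hx
  rw [← hx, pow_add, Polynomial.coeff_coe]
  ring

theorem LSystem.not_summable (hq : q ≠ 0)
    (hP : ∀ (i : I) (z : rootsOfUnity N ℂ), (S.P i).eval (((z : ℂˣ) : ℂ) * q⁻¹) ≠ 0)
    (c : I → ℂ) (hc : c i₀ ≠ 0) :
    ¬ Summable fun n => ‖(∑ i, ∑ z : rootsOfUnity N ℂ, c i * ((z : ℂˣ) : ℂ)⁻¹ *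
      (((z : ℂˣ) : ℂ) ^ n * PowerSeries.coeff n (S.Ψ i))) * q⁻¹ ^ n‖ := by
  classical
  intro hs
  set f : I × rootsOfUnity N ℂ → PowerSeries ℂ := fun x =>
    PowerSeries.C (c x.1 * ((x.2 : ℂˣ) : ℂ)⁻¹) *
      PowerSeries.rescale ((x.2 : ℂˣ) : ℂ) (S.Ψ x.1) with hf
  have hreg : ∀ x ∈ Finset.univ.erase (i₀, (1 : rootsOfUnity N ℂ)), RegularAt q⁻¹ (f x) := by
    rintro ⟨i, z⟩ hx
    refine RegularAt.C_mul ?_ _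
    by_cases hi : i = i₀
    · subst hi
      have hz : ((z : ℂˣ) : ℂ) ≠ 1 := by
        intro h
        refine Finset.ne_of_mem_erase hx ?_
        rw [Prod.mk.injEq]
        exact ⟨rfl, Subtype.ext (Units.ext h)⟩
      refine ⟨((1 - C q * X) * S.P i).comp (C ((z : ℂˣ) : ℂ) * X),
        (C q * X * S.P i + (1 - C q * X) * (X * derivative (S.P i))).comp
          (C ((z : ℂˣ) : ℂ) * X), ?_, by
            rw [← rescale_coe, ← map_mul, S.pole_identity, rescale_coe]⟩
      · have := hP i z
        simp only [mul_comp, sub_comp, one_comp, C_comp, X_comp, eval_mul, eval_sub, eval_one,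
          eval_C, eval_X, eval_comp]
        refine mul_ne_zero ?_ this
        rw [mul_left_comm, mul_inv_cancel₀ hq, mul_one]
        exact sub_ne_zero.2 hz.symm
    · refine ⟨(S.P i).comp (C ((z : ℂˣ) : ℂ) * X),
        (X * derivative (S.P i)).comp (C ((z : ℂˣ) : ℂ) * X), ?_, ?_⟩
      · simpa [eval_comp] using hP i z
      · rw [← rescale_coe, ← map_mul, ← rescale_coe, ← S.eq_of_ne i hi, ← S.logDeriv i,
          S.eq_of_ne i hi, PowerSeries.derivative_coe]
        push_cast
        rfl
  obtain ⟨D, M, hD, hDM⟩ := RegularAt.sum _ hreg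
  set E : PowerSeries ℂ := ∑ x, f x with hE
  have hEc : ∀ n, PowerSeries.coeff n E = ∑ i, ∑ z : rootsOfUnity N ℂ, c i * ((z : ℂˣ) : ℂ)⁻¹ *
      (((z : ℂˣ) : ℂ) ^ n * PowerSeries.coeff n (S.Ψ i)) := by
    intro n
    rw [hE, map_sum, ← Finset.univ_product_univ, Finset.sum_product]
    simp only [hf, PowerSeries.coeff_C_mul, PowerSeries.coeff_rescale]
  have hf0 : f (i₀, 1) = PowerSeries.C (c i₀) * S.Ψ i₀ := by
    simp [hf]
  have hE' : E = f (i₀, 1) + ∑ x ∈ Finset.univ.erase (i₀, (1 : rootsOfUnity N ℂ)), f x :=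
    (Finset.add_sum_erase _ _ (Finset.mem_univ _)).symm
  have hpi := S.pole_identity
  have hprod : E * (((1 - C q * X) * S.P i₀ * D : ℂ[X]) : PowerSeries ℂ) =
      ((C (c i₀) * (C q * X * S.P i₀ + (1 - C q * X) * (X * derivative (S.P i₀))) * D +
        (1 - C q * X) * S.P i₀ * M : ℂ[X]) : PowerSeries ℂ) := by
    rw [hE', hf0]
    push_cast at hpi ⊢
    linear_combination PowerSeries.C (c i₀) * (D : PowerSeries ℂ) * hpi +
      (1 - PowerSeries.C q * PowerSeries.X) * (S.P i₀ : PowerSeries ℂ) * hDM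
  have hz := eval_eq_zero_of_summable (r := q⁻¹) (f := E) (by simpa only [hEc] using hs) hprod
    (by simp [hq])
  have hP1 := hP i₀ 1
  simp [hq, hc, hD] at hz hP1
  exact hP1 hz

end Abstract

section Characters

theorem sum_rootsOfUnity_pow {N : ℕ} [NeZero N] [Fintype (rootsOfUnity N ℂ)] (n : ℕ) :
    ∑ z : rootsOfUnity N ℂ, ((z : ℂˣ) : ℂ) ^ n =
      if N ∣ n then (Fintype.card (rootsOfUnity N ℂ) : ℂ) else 0 := by
  have hp := Complex.isPrimitiveRoot_exp N (NeZero.ne N)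
  split_ifs with h
  · obtain ⟨k, rfl⟩ := h
    have : ∀ z : rootsOfUnity N ℂ, ((z : ℂˣ) : ℂ) ^ (N * k) = 1 := by
      intro z
      have := z.2
      rw [mem_rootsOfUnity'] at this
      rw [pow_mul, this, one_pow]
    simp [this]
  · set ω := hp.toRootsOfUnity
    have hω : ((ω : ℂˣ) : ℂ) ^ n ≠ 1 := fun h1 => h (hp.dvd_of_pow_eq_one n h1)
    have h2 : ∑ z : rootsOfUnity N ℂ, ((z : ℂˣ) : ℂ) ^ n =
        ((ω : ℂˣ) : ℂ) ^ n * ∑ z : rootsOfUnity N ℂ, ((z : ℂˣ) : ℂ) ^ n := by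
      rw [Finset.mul_sum]
      conv_lhs => rw [← Equiv.sum_comp (Equiv.mulLeft ω)]
      simp [mul_pow]
    have h3 : (((ω : ℂˣ) : ℂ) ^ n - 1) * ∑ z : rootsOfUnity N ℂ, ((z : ℂˣ) : ℂ) ^ n = 0 := by
      linear_combination -h2
    exact (mul_eq_zero.1 h3).resolve_left (sub_ne_zero.2 hω)

variable {R : Type*} [CommRing R] [Finite R] [Fintype (MulChar R ℂ)]

open Classical in
theorem sum_mulChar_apply (x : R) :
    ∑ χ : MulChar R ℂ, χ x = if x = 1 then (Fintype.card (MulChar R ℂ) : ℂ) else 0 := by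
  split_ifs with h
  · subst h; simp
  · obtain ⟨η, hη⟩ := MulChar.exists_apply_ne_one_of_hasEnoughRootsOfUnity R ℂ h
    have h2 : ∑ χ : MulChar R ℂ, χ x = η x * ∑ χ : MulChar R ℂ, χ x := by
      rw [Finset.mul_sum]
      conv_lhs => rw [← Equiv.sum_comp (Equiv.mulLeft η)]
      simp
    have h3 : (η x - 1) * ∑ χ : MulChar R ℂ, χ x = 0 := by linear_combination -h2
    exact (mul_eq_zero.1 h3).resolve_left (sub_ne_zero.2 hη)

end Characters

section Quotient

variable {F : Type*} [Field F] {a : F[X]}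

/-- The Dirichlet character of `F[X]` given by a multiplicative character modulo `a`. -/
noncomputable def dirichletHom (χ : MulChar (F[X] ⧸ Ideal.span {a}) ℂ) : F[X] →* ℂ :=
  χ.toMonoidHom.comp (Ideal.Quotient.mk (Ideal.span {a}) : F[X] →* F[X] ⧸ Ideal.span {a})

theorem dirichletHom_apply (χ : MulChar (F[X] ⧸ Ideal.span {a}) ℂ) (f : F[X]) :
    dirichletHom χ f = χ (Ideal.Quotient.mk (Ideal.span {a}) f) := rfl

theorem isUnit_mk_iff {f : F[X]} :
    IsUnit (Ideal.Quotient.mk (Ideal.span {a}) f) ↔ IsCoprime a f := by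
  rw [isUnit_iff_exists_inv]
  constructor
  · rintro ⟨y, hy⟩
    obtain ⟨g, rfl⟩ := Ideal.Quotient.mk_surjective y
    rw [← map_mul, ← map_one (Ideal.Quotient.mk _), Ideal.Quotient.eq,
      Ideal.mem_span_singleton] at hy
    obtain ⟨k, hk⟩ := hy
    exact ⟨-k, g, by linear_combination hk⟩
  · rintro ⟨u, v, h⟩
    refine ⟨Ideal.Quotient.mk _ v, ?_⟩
    rw [← map_mul, ← map_one (Ideal.Quotient.mk _), Ideal.Quotient.eq, Ideal.mem_span_singleton]
    exact ⟨-u, by linear_combination h⟩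

theorem dirichletHom_one_apply_of_irreducible {π : F[X]} (hπ : Irreducible π) [Decidable (π ∣ a)] :
    dirichletHom (1 : MulChar (F[X] ⧸ Ideal.span {a}) ℂ) π = if π ∣ a then 0 else 1 := by
  rw [dirichletHom_apply]
  split_ifs with h
  · refine MulChar.map_nonunit _ fun hu => ?_
    rw [isUnit_mk_iff] at hu
    exact (hπ.coprime_iff_not_dvd.1 hu.symm) h
  · exact MulChar.one_apply (isUnit_mk_iff.2 (hπ.coprime_iff_not_dvd.2 h).symm)

theorem isLogDeriv_one_sub_X_pow {m : ℕ} (hm : 0 < m) :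
    IsLogDeriv ((1 - X ^ m : ℂ[X]) : PowerSeries ℂ)
      (PowerSeries.mk fun n => if m ∈ n.divisors then -(m : ℂ) else 0) := by
  unfold IsLogDeriv
  ext n
  rw [coeff_X_mul_derivative]
  push_cast
  rw [mul_sub, mul_one, map_sub, map_sub, PowerSeries.coeff_mul_X_pow', PowerSeries.coeff_one,
    PowerSeries.coeff_X_pow, PowerSeries.coeff_mk]
  rcases lt_trichotomy n m with h | h | h
  · have h1 : ¬ m ∈ n.divisors := by
      intro h'
      have := Nat.divisor_le h'
      omega
    rw [if_neg h1, if_neg (show ¬ n = m by omega), if_neg (show ¬ m ≤ n by omega)]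
    split_ifs with h2 <;> simp [h2]
  · subst h
    simp [hm.ne']
  · rw [if_neg (by omega), if_neg (by omega), if_pos h.le, PowerSeries.coeff_mk]
    have : m ∈ n.divisors ↔ m ∈ (n - m).divisors := by
      rw [Nat.mem_divisors, Nat.mem_divisors, Nat.dvd_sub_iff_left h.le dvd_rfl]
      constructor <;> rintro ⟨h1, -⟩ <;> exact ⟨h1, by omega⟩
    simp [this]

open Classical in
/-- The set of monic irreducible divisors of `a`. -/
noncomputable def primeDivisors (a : F[X]) : Finset F[X] :=
  (UniqueFactorizationMonoid.normalizedFactors a).toFinset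

theorem mem_primeDivisors (ha : a ≠ 0) {π : F[X]} :
    π ∈ primeDivisors a ↔ π.Monic ∧ Irreducible π ∧ π ∣ a := by
  classical
  rw [primeDivisors, Multiset.mem_toFinset, UniqueFactorizationMonoid.mem_normalizedFactors_iff' ha]
  constructor
  · rintro ⟨h1, h2, h3⟩
    exact ⟨h2 ▸ monic_normalize h1.ne_zero, h1, h3⟩
  · rintro ⟨h1, h2, h3⟩
    exact ⟨h2, h1.normalize_eq_self, h3⟩

variable [Fintype F]

theorem finite_quotient (ha : a ≠ 0) : Finite (F[X] ⧸ Ideal.span {a}) := by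
  have : Finite (degreeLT F a.natDegree) := Module.finite_of_finite F
  refine Finite.of_surjective
    (fun f : degreeLT F a.natDegree => Ideal.Quotient.mk (Ideal.span {a}) f.1) ?_
  intro x
  obtain ⟨f, rfl⟩ := Ideal.Quotient.mk_surjective x
  refine ⟨⟨f % a, ?_⟩, ?_⟩
  · rw [mem_degreeLT, ← degree_eq_natDegree ha]
    exact EuclideanDomain.mod_lt f ha
  · rw [Ideal.Quotient.eq, Ideal.mem_span_singleton]
    exact ⟨-(f / a), by linear_combination EuclideanDomain.mod_add_div f a⟩

theorem monicSum_eq_zero (ha : a ≠ 0) {χ : MulChar (F[X] ⧸ Ideal.span {a}) ℂ} (hχ : χ ≠ 1)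
    {n : ℕ} (hn : a.natDegree ≤ n) : monicSum (dirichletHom χ) n = 0 := by
  classical
  have := finite_quotient ha
  have : Fintype (F[X] ⧸ Ideal.span {a}) := Fintype.ofFinite _
  have hrep : ∀ r : F[X] ⧸ Ideal.span {a}, ∃ h : F[X],
      Ideal.Quotient.mk (Ideal.span {a}) h = r ∧ h.degree < n := by
    intro r
    obtain ⟨f, rfl⟩ := Ideal.Quotient.mk_surjective r
    refine ⟨f % a, ?_, ?_⟩
    · rw [Ideal.Quotient.eq, Ideal.mem_span_singleton]
      exact ⟨-(f / a), by linear_combination EuclideanDomain.mod_add_div f a⟩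
    · refine lt_of_lt_of_le (EuclideanDomain.mod_lt f ha) ?_
      rw [degree_eq_natDegree ha]
      exact_mod_cast hn
  choose rep hrep hdeg using hrep
  have hmem : ∀ h f : F[X], h.degree < n → f ∈ monics F n → f + h ∈ monics F n := by
    intro h f hh hf
    obtain ⟨hfm, hfd⟩ := mem_monics.1 hf
    have hd : h.degree < f.degree := by rwa [degree_eq_natDegree hfm.ne_zero, hfd]
    exact mem_monics.2 ⟨hfm.add_of_left hd, by rw [natDegree_add_eq_left_of_degree_lt hd, hfd]⟩
  have hperm : ∀ r, monicSum (dirichletHom χ) n =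
      ∑ f ∈ monics F n, χ (Ideal.Quotient.mk (Ideal.span {a}) f + r) := by
    intro r
    refine Finset.sum_bij' (fun f _ => f - rep r) (fun f _ => f + rep r) ?_ ?_ ?_ ?_ ?_
    · intro f hf
      rw [sub_eq_add_neg]
      exact hmem _ _ (by rw [degree_neg]; exact hdeg r) hf
    · intro f hf; exact hmem _ _ (hdeg r) hf
    · intro f _; ring
    · intro f _; ring
    · intro f _
      rw [dirichletHom_apply, map_sub, hrep, sub_add_cancel]
  have hsum : ∑ _r : F[X] ⧸ Ideal.span {a}, monicSum (dirichletHom χ) n = 0 := by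
    rw [Finset.sum_congr rfl fun r _ => hperm r, Finset.sum_comm]
    refine Finset.sum_eq_zero fun f _ => ?_
    rw [← MulChar.sum_eq_zero_of_ne_one hχ]
    exact Equiv.sum_comp (Equiv.addLeft (Ideal.Quotient.mk (Ideal.span {a}) f)) (fun r => χ r)
  rw [Finset.sum_const, nsmul_eq_mul] at hsum
  refine (mul_eq_zero.1 hsum).resolve_left ?_
  rw [Finset.card_univ]
  exact_mod_cast Fintype.card_ne_zero

theorem isLogDeriv_monicSum (χ : F[X] →* ℂ) :
    IsLogDeriv (PowerSeries.mk (monicSum χ)) (PowerSeries.mk (primeSum χ)) := by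
  unfold IsLogDeriv
  ext n
  rw [coeff_X_mul_derivative, PowerSeries.coeff_mk, natCast_mul_monicSum, PowerSeries.coeff_mul]
  simp

theorem monicSum_zero (χ : F[X] →* ℂ) : monicSum χ 0 = 1 := by
  have : monics F 0 = {1} := by
    ext f
    rw [mem_monics, Finset.mem_singleton]
    constructor
    · rintro ⟨h, h'⟩; exact h.natDegree_eq_zero.1 h'
    · rintro rfl; simp
  simp [monicSum, this]

/-- The Euler factors at the primes dividing `a`. -/
noncomputable def eulerFactor (a : F[X]) : ℂ[X] :=
  ∏ π ∈ primeDivisors a, (1 - X ^ π.natDegree)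

theorem isLogDeriv_principal (ha : a ≠ 0) :
    IsLogDeriv (PowerSeries.mk (monicSum (1 : F[X] →* ℂ)) * (eulerFactor a : PowerSeries ℂ))
      (PowerSeries.mk (primeSum (dirichletHom (1 : MulChar (F[X] ⧸ Ideal.span {a}) ℂ)))) := by
  classical
  have h1 : IsLogDeriv (eulerFactor a : PowerSeries ℂ) (∑ π ∈ primeDivisors a,
      PowerSeries.mk fun n => if π.natDegree ∈ n.divisors then -(π.natDegree : ℂ) else 0) := by
    have : (eulerFactor a : PowerSeries ℂ) =
        ∏ π ∈ primeDivisors a, ((1 - X ^ π.natDegree : ℂ[X]) : PowerSeries ℂ) :=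
      map_prod (Polynomial.coeToPowerSeries.ringHom (R := ℂ)) _ _
    rw [this]
    exact IsLogDeriv.prod _ fun π hπ =>
      isLogDeriv_one_sub_X_pow ((mem_primeDivisors ha).1 hπ).2.1.natDegree_pos
  convert (isLogDeriv_monicSum (1 : F[X] →* ℂ)).mul h1 using 1
  ext n
  rw [map_add, map_sum]
  simp only [PowerSeries.coeff_mk]
  have h2 : ∑ π ∈ primeDivisors a,
      (if π.natDegree ∈ n.divisors then -(π.natDegree : ℂ) else 0) =
      ∑ m ∈ n.divisors, ∑ π ∈ primes F m, if π ∣ a then -(m : ℂ) else 0 := by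
    rw [← Finset.sum_filter]
    simp_rw [← Finset.sum_filter]
    rw [Finset.sum_sigma']
    refine Finset.sum_bij' (fun π _ => ⟨π.natDegree, π⟩) (fun x _ => x.2) ?_ ?_ ?_ ?_ ?_
    · intro π hπ
      rw [Finset.mem_filter, mem_primeDivisors ha] at hπ
      simp only [Finset.mem_sigma, Finset.mem_filter, mem_primes]
      tauto
    · rintro ⟨m, π⟩ hx
      simp only [Finset.mem_sigma, Finset.mem_filter, mem_primes] at hx
      rw [Finset.mem_filter, mem_primeDivisors ha, hx.2.1.1.2]
      tauto
    · intro π _; rfl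
    · rintro ⟨m, π⟩ hx
      simp only [Finset.mem_sigma, Finset.mem_filter, mem_primes] at hx
      simp [hx.2.1.1.2]
    · intro π _; rfl
  rw [h2, primeSum, primeSum, ← Finset.sum_add_distrib]
  refine Finset.sum_congr rfl fun m hm => ?_
  rw [Finset.mul_sum, Finset.mul_sum, ← Finset.sum_add_distrib]
  refine Finset.sum_congr rfl fun π hπ => ?_
  have hnm : n / m ≠ 0 := by
    rw [Nat.mem_divisors] at hm
    exact (Nat.div_pos (Nat.le_of_dvd (Nat.pos_of_ne_zero hm.2) hm.1)
      (Nat.pos_of_dvd_of_pos hm.1 (Nat.pos_of_ne_zero hm.2))).ne'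
  rw [dirichletHom_one_apply_of_irreducible (mem_primes.1 hπ).2]
  split_ifs <;> simp [hnm]

open Classical in
/-- The system of Dirichlet L-series modulo `a`. -/
noncomputable def dirichletSystem (ha : a ≠ 0) :
    LSystem (MulChar (F[X] ⧸ Ideal.span {a}) ℂ) 1 (Fintype.card F : ℂ) where
  L χ := if χ = 1 then PowerSeries.mk (monicSum (1 : F[X] →* ℂ)) * (eulerFactor a : PowerSeries ℂ)
    else PowerSeries.mk (monicSum (dirichletHom χ))
  Ψ χ := PowerSeries.mk (primeSum (dirichletHom χ))
  P χ := if χ = 1 then eulerFactor a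
    else ∑ n ∈ Finset.range a.natDegree, monomial n (monicSum (dirichletHom χ) n)
  logDeriv χ := by
    split_ifs with h
    · subst h; exact isLogDeriv_principal ha
    · exact isLogDeriv_monicSum _
  coeff_zero χ := by
    split_ifs with h
    · rw [PowerSeries.coeff_zero_eq_constantCoeff_apply, map_mul,
        ← PowerSeries.coeff_zero_eq_constantCoeff_apply, PowerSeries.coeff_mk, monicSum_zero,
        one_mul, ← PowerSeries.coeff_zero_eq_constantCoeff_apply, Polynomial.coeff_coe,
        coeff_zero_eq_eval_zero, eulerFactor, eval_prod]
      refine Finset.prod_eq_one fun π hπ => ?_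
      simp [((mem_primeDivisors ha).1 hπ).2.1.natDegree_pos.ne']
    · rw [PowerSeries.coeff_mk, monicSum_zero]
  eq_of_ne χ hχ := by
    rw [if_neg hχ, if_neg hχ]
    ext n
    rw [PowerSeries.coeff_mk, Polynomial.coeff_coe, finsetSum_coeff]
    simp only [coeff_monomial, Finset.sum_ite_eq', Finset.mem_range]
    split_ifs with h
    · rfl
    · exact monicSum_eq_zero ha hχ (not_lt.1 h)
  mul_eq := by
    rw [if_pos rfl, if_pos rfl, mul_right_comm]
    convert one_mul (eulerFactor a : PowerSeries ℂ)
    ext n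
    have h1 : ∀ n, monicSum (1 : F[X] →* ℂ) n = (Fintype.card F : ℂ) ^ n := by
      intro n
      simp [monicSum, card_monics]
    have : ((1 - C (Fintype.card F : ℂ) * X : ℂ[X]) : PowerSeries ℂ) =
        1 - PowerSeries.C (Fintype.card F : ℂ) * PowerSeries.X := coe_linear _
    rw [this, mul_sub, mul_one, map_sub, mul_left_comm, PowerSeries.coeff_C_mul]
    cases n with
    | zero => simp [h1]
    | succ n =>
      rw [PowerSeries.coeff_succ_mul_X, PowerSeries.coeff_mk, PowerSeries.coeff_mk, h1, h1,
        PowerSeries.coeff_one, if_neg (by omega)]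
      ring

end Quotient

section Dirichlet

variable {F : Type*} [Field F] [Fintype F] {a : F[X]}

open Classical in
/-- The sum of the von Mangoldt function over the monic polynomials of degree `n` in the
residue class `r` modulo `a`. -/
noncomputable def primeCount (r : F[X] ⧸ Ideal.span {a}) (n : ℕ) : ℕ :=
  ∑ m ∈ n.divisors,
    m * ((primes F m).filter fun π => Ideal.Quotient.mk (Ideal.span {a}) π ^ (n / m) = r).card

theorem sum_mulChar_mul_primeSum (ha : a ≠ 0) [Fintype (MulChar (F[X] ⧸ Ideal.span {a}) ℂ)]
    (r : (F[X] ⧸ Ideal.span {a})ˣ) (n : ℕ) :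
    ∑ χ : MulChar (F[X] ⧸ Ideal.span {a}) ℂ, χ (r⁻¹ : (F[X] ⧸ Ideal.span {a})ˣ) *
      primeSum (dirichletHom χ) n =
      Fintype.card (MulChar (F[X] ⧸ Ideal.span {a}) ℂ) *
        primeCount (r : F[X] ⧸ Ideal.span {a}) n := by
  classical
  have := finite_quotient ha
  simp only [primeSum, primeCount, Finset.mul_sum]
  push_cast
  rw [Finset.sum_comm, Finset.mul_sum]
  refine Finset.sum_congr rfl fun m _ => ?_
  rw [Finset.sum_comm, Finset.natCast_card_filter, Finset.mul_sum, Finset.mul_sum]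
  refine Finset.sum_congr rfl fun π _ => ?_
  have h1 : ∀ χ : MulChar (F[X] ⧸ Ideal.span {a}) ℂ,
      χ (r⁻¹ : (F[X] ⧸ Ideal.span {a})ˣ) * ((m : ℂ) * dirichletHom χ π ^ (n / m)) =
      m * χ ((r⁻¹ : (F[X] ⧸ Ideal.span {a})ˣ) *
        Ideal.Quotient.mk (Ideal.span {a}) π ^ (n / m)) := by
    intro χ
    rw [dirichletHom_apply, map_mul, map_pow]; ring
  rw [Finset.sum_congr rfl fun χ _ => h1 χ, ← Finset.mul_sum, sum_mulChar_apply]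
  simp only [Units.inv_mul_eq_iff_eq_mul, mul_one]
  split_ifs <;> ring

theorem exists_primeCount_ne_zero (ha : a ≠ 0) {N : ℕ} (hN : 0 < N) (B : ℕ) :
    ∃ n > B, N ∣ n ∧ primeCount (1 : F[X] ⧸ Ideal.span {a}) n ≠ 0 := by
  classical
  have := finite_quotient ha
  have hdeg : (X * a + 1 : F[X]).natDegree = a.natDegree + 1 := by
    rw [natDegree_add_eq_left_of_natDegree_lt, natDegree_X_mul ha]
    rw [natDegree_X_mul ha, natDegree_one]; omega
  have hne : (X * a + 1 : F[X]) ≠ 0 := by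
    intro h; rw [h, natDegree_zero] at hdeg; omega
  have hnu : ¬ IsUnit (X * a + 1 : F[X]) := by
    intro h; rw [natDegree_eq_zero_of_isUnit h] at hdeg; omega
  obtain ⟨π₀, hπ₀, hdvd₀⟩ := WfDvdMonoid.exists_irreducible_factor hnu hne
  set π := normalize π₀ with hπdef
  have hassoc : Associated π₀ π := associated_normalize π₀
  have hπ : Irreducible π := hassoc.irreducible hπ₀
  have hmon : π.Monic := monic_normalize hπ₀.ne_zero
  have hdvd : π ∣ X * a + 1 := hassoc.symm.dvd.trans hdvd₀
  have hcop : IsCoprime a π := by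
    obtain ⟨k, hk⟩ := hdvd
    exact ⟨-X, k, by linear_combination -hk⟩
  obtain ⟨u, hu⟩ := isUnit_mk_iff.2 hcop
  have : Fintype (F[X] ⧸ Ideal.span {a})ˣ := Fintype.ofFinite _
  set K := Fintype.card (F[X] ⧸ Ideal.span {a})ˣ with hK
  have hKpos : 0 < K := Fintype.card_pos
  have hd : 0 < π.natDegree := hπ.natDegree_pos
  set k := K * N * (B + 1) with hk
  have hkB : B + 1 ≤ k := Nat.le_mul_of_pos_left _ (Nat.mul_pos hKpos hN)
  refine ⟨π.natDegree * k, ?_, ?_, ?_⟩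
  · nlinarith
  · exact Dvd.dvd.mul_left (Dvd.dvd.mul_right (dvd_mul_left _ _) _) _
  · intro h0
    rw [primeCount, Finset.sum_eq_zero_iff] at h0
    have h1 := h0 π.natDegree (Nat.mem_divisors.2 ⟨dvd_mul_right _ _, by positivity⟩)
    rw [mul_eq_zero, or_iff_right hd.ne', Finset.card_eq_zero] at h1
    refine (Finset.eq_empty_iff_forall_notMem.1 h1 π) ?_
    rw [Finset.mem_filter, mem_primes, Nat.mul_div_cancel_left _ hd]
    refine ⟨⟨⟨hmon, rfl⟩, hπ⟩, ?_⟩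
    rw [← hu, ← Units.val_pow_eq_pow_val, hk, mul_assoc, pow_mul, pow_card_eq_one, one_pow,
      Units.val_one]

theorem primeCount_le {r : F[X] ⧸ Ideal.span {a}} {n : ℕ}
    (h : ∀ π ∈ primes F n, Ideal.Quotient.mk (Ideal.span {a}) π ≠ r) :
    primeCount r n ≤ n ^ 2 * Fintype.card F ^ (n / 2) := by
  classical
  have hterm : ∀ m ∈ n.divisors, m * ((primes F m).filter
      fun π => Ideal.Quotient.mk (Ideal.span {a}) π ^ (n / m) = r).card ≤
      n * Fintype.card F ^ (n / 2) := by
    intro m hm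
    rw [Nat.mem_divisors] at hm
    obtain ⟨⟨k, rfl⟩, h0⟩ := hm
    have hm0 : 0 < m := Nat.pos_of_ne_zero (left_ne_zero_of_mul h0)
    have hk0 : 0 < k := Nat.pos_of_ne_zero (right_ne_zero_of_mul h0)
    rw [Nat.mul_div_cancel_left _ hm0]
    rcases Nat.eq_or_lt_of_le (Nat.succ_le_of_lt hk0) with hk | hk
    · obtain rfl : k = 1 := hk.symm
      rw [mul_one] at h
      rw [Finset.filter_false_of_mem]
      · simp
      · intro π hπ; rw [pow_one]; exact h π hπ
    · refine Nat.mul_le_mul (Nat.le_mul_of_pos_right _ hk0) ?_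
      refine (Finset.card_filter_le _ _).trans ((card_primes_le m).trans ?_)
      refine Nat.pow_le_pow_right Fintype.card_pos ?_
      rw [Nat.le_div_iff_mul_le two_pos]
      exact Nat.mul_le_mul le_rfl hk
  refine (Finset.sum_le_sum hterm).trans ?_
  rw [Finset.sum_const, smul_eq_mul, sq, mul_assoc]
  exact Nat.mul_le_mul (Nat.card_divisors_le_self n) le_rfl

open ComplexOrder in
/-- Dirichlet's theorem in `F[X]`, with control of the degree modulo `N`. -/
theorem exists_irreducible_dvd_sub (ha : a ≠ 0) {c : F[X]} (hc : IsCoprime a c) {N : ℕ}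
    (hN : 0 < N) (B : ℕ) : ∃ π : F[X], π.Monic ∧ Irreducible π ∧ a ∣ π - c ∧
      π.natDegree ≡ 1 [MOD N] ∧ B < π.natDegree := by
  classical
  by_contra hcon
  push Not at hcon
  have := finite_quotient ha
  have : NeZero N := ⟨hN.ne'⟩
  have : Fintype (rootsOfUnity N ℂ) := Fintype.ofFinite _
  have : Fintype (MulChar (F[X] ⧸ Ideal.span {a}) ℂ) := Fintype.ofFinite _
  set S := dirichletSystem ha with hS
  have hΨ : ∀ χ n, PowerSeries.coeff n (S.Ψ χ) = primeSum (dirichletHom χ) n := by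
    intro χ n
    exact PowerSeries.coeff_mk n (primeSum (dirichletHom χ))
  have hq2 : 2 ≤ Fintype.card F := Fintype.one_lt_card
  have hq : (Fintype.card F : ℂ) ≠ 0 := by exact_mod_cast (by omega : Fintype.card F ≠ 0)
  have hone : ∀ n, ∑ z : rootsOfUnity N ℂ, ∑ χ, ((z : ℂˣ) : ℂ) ^ n *
      PowerSeries.coeff n (S.Ψ χ) = ((if N ∣ n then Fintype.card (rootsOfUnity N ℂ) else 0) *
        (Fintype.card (MulChar (F[X] ⧸ Ideal.span {a}) ℂ) *
          primeCount (1 : F[X] ⧸ Ideal.span {a}) n) : ℕ) := by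
    intro n
    have h1 := sum_mulChar_mul_primeSum ha 1 n
    simp only [inv_one, Units.val_one, map_one, one_mul] at h1
    simp only [hΨ]
    rw [← Finset.sum_mul_sum, sum_rootsOfUnity_pow, h1]
    push_cast
    rfl
  have hP := S.eval_ne_zero N hq (fun n => by rw [hone]; exact Nat.cast_nonneg _) (fun B => by
    obtain ⟨n, hn, hNn, h0⟩ := exists_primeCount_ne_zero ha hN B
    refine ⟨n, hn, ?_⟩
    rw [hone, if_pos hNn]
    exact_mod_cast mul_ne_zero Fintype.card_ne_zero (mul_ne_zero Fintype.card_ne_zero h0))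
  obtain ⟨r, hr⟩ := isUnit_mk_iff.2 hc
  refine S.not_summable N hq hP
    (fun χ => χ (r⁻¹ : (F[X] ⧸ Ideal.span {a})ˣ)) (by simp) ?_
  set K := Fintype.card (rootsOfUnity N ℂ) with hK
  set G := Fintype.card (MulChar (F[X] ⧸ Ideal.span {a}) ℂ) with hG
  have hval : ∀ n, 0 < n → ∑ χ : MulChar (F[X] ⧸ Ideal.span {a}) ℂ, ∑ z : rootsOfUnity N ℂ,
      χ (r⁻¹ : (F[X] ⧸ Ideal.span {a})ˣ) * ((z : ℂˣ) : ℂ)⁻¹ *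
        (((z : ℂˣ) : ℂ) ^ n * PowerSeries.coeff n (S.Ψ χ)) =
      ((if N ∣ n - 1 then K else 0) * (G * primeCount (r : F[X] ⧸ Ideal.span {a}) n) : ℕ) := by
    intro n hn
    obtain ⟨k, rfl⟩ : ∃ k, n = k + 1 := ⟨n - 1, by omega⟩
    have h1 := sum_mulChar_mul_primeSum ha r (k + 1)
    push_cast
    rw [← h1, ← sum_rootsOfUnity_pow, mul_comm, Finset.sum_mul_sum]
    refine Finset.sum_congr rfl fun χ _ => Finset.sum_congr rfl fun z _ => ?_
    have hz : ((z : ℂˣ) : ℂ) ≠ 0 := (z : ℂˣ).ne_zero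
    rw [hΨ, pow_succ]
    field_simp
  set s : ℝ := (Real.sqrt (Fintype.card F))⁻¹ with hs
  have hsq : (1 : ℝ) < Real.sqrt (Fintype.card F) := by
    rw [Real.lt_sqrt zero_le_one]
    have : (2 : ℝ) ≤ Fintype.card F := by exact_mod_cast hq2
    linarith
  have hs0 : 0 ≤ s := by positivity
  have hs1 : ‖s‖ < 1 := by
    rw [Real.norm_of_nonneg hs0]
    exact inv_lt_one_of_one_lt₀ hsq
  refine Summable.of_norm_bounded_eventually_nat
    (g := fun n => (K * G : ℝ) * ((n : ℝ) ^ 2 * s ^ n))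
    ((summable_pow_mul_geometric_of_norm_lt_one 2 hs1).mul_left _) ?_
  filter_upwards [Filter.eventually_gt_atTop B] with n hn
  rw [hval n (by omega), norm_norm, norm_mul, Complex.norm_natCast, norm_pow, norm_inv,
    Complex.norm_natCast]
  by_cases hNn : N ∣ n - 1
  · rw [if_pos hNn]
    have hle := primeCount_le (r := (r : F[X] ⧸ Ideal.span {a})) (n := n) (by
      intro π hπ h
      obtain ⟨⟨h1, h2⟩, h3⟩ := mem_primes.1 hπ
      rw [hr, Ideal.Quotient.eq, Ideal.mem_span_singleton] at h
      have := hcon π h1 h3 h (by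
        rw [h2]
        exact ((Nat.modEq_iff_dvd' (by omega)).2 hNn).symm)
      omega)
    have hle' : (primeCount (r : F[X] ⧸ Ideal.span {a}) n : ℝ) ≤
        (n : ℝ) ^ 2 * Real.sqrt (Fintype.card F) ^ n := by
      refine (Nat.cast_le.2 hle).trans ?_
      push_cast
      refine mul_le_mul_of_nonneg_left ?_ (by positivity)
      have : (Fintype.card F : ℝ) = Real.sqrt (Fintype.card F) ^ 2 := by
        rw [Real.sq_sqrt (by positivity)]
      conv_lhs => rw [this, ← pow_mul]
      exact pow_le_pow_right₀ hsq.le (Nat.mul_div_le n 2)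
    have hcard : ((Fintype.card F : ℝ)⁻¹) ^ n = s ^ n * s ^ n := by
      rw [← mul_pow, hs, ← mul_inv, Real.mul_self_sqrt (by positivity)]
    rw [hcard]
    push_cast
    have hss : Real.sqrt (Fintype.card F) ^ n * s ^ n = 1 := by
      rw [← mul_pow, hs, mul_inv_cancel₀ (by positivity), one_pow]
    calc (K : ℝ) * (G * primeCount (r : F[X] ⧸ Ideal.span {a}) n) * (s ^ n * s ^ n)
        ≤ (K : ℝ) * (G * ((n : ℝ) ^ 2 * Real.sqrt (Fintype.card F) ^ n)) * (s ^ n * s ^ n) := by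
          gcongr
      _ = (K * G : ℝ) * ((n : ℝ) ^ 2 * s ^ n) *
          (Real.sqrt (Fintype.card F) ^ n * s ^ n) := by ring
      _ = (K * G : ℝ) * ((n : ℝ) ^ 2 * s ^ n) := by rw [hss, mul_one]
  · rw [if_neg hNn, zero_mul, Nat.cast_zero, zero_mul]
    positivity

end Dirichlet

section Norm

variable {F : Type*} [Field F]

theorem resultant_mul_resultant_eq {a c f : F[X]} (h : a ∣ f - c) :
    a.leadingCoeff ^ c.natDegree * resultant a f a.natDegree f.natDegree =
      a.leadingCoeff ^ f.natDegree * resultant a c a.natDegree c.natDegree := by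
  apply (algebraMap F (AlgebraicClosure F)).injective
  have key : ∀ g : F[X], algebraMap F (AlgebraicClosure F)
      (resultant a g a.natDegree g.natDegree) =
      algebraMap F (AlgebraicClosure F) a.leadingCoeff ^ g.natDegree *
        ((a.aroots (AlgebraicClosure F)).map fun y => aeval y g).prod := by
    intro g
    have := resultant_eq_prod_eval (a.map (algebraMap F (AlgebraicClosure F)))
      (g.map (algebraMap F (AlgebraicClosure F))) g.natDegree (by simp) (IsAlgClosed.splits _)
    rw [natDegree_map, leadingCoeff_map] at this
    rw [← resultant_map_map, this, aroots_def]
    simp [eval_map_algebraMap]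
  rw [map_mul, map_mul, map_pow, map_pow, key, key]
  have : (a.aroots (AlgebraicClosure F)).map (fun y => aeval y f) =
      (a.aroots (AlgebraicClosure F)).map fun y => aeval y c := by
    refine Multiset.map_congr rfl fun y hy => ?_
    obtain ⟨d, hd⟩ := h
    have hy' : aeval y a = 0 := (mem_aroots.mp hy).2
    have := congrArg (aeval y) hd
    rw [map_sub, map_mul, hy', zero_mul] at this
    exact sub_eq_zero.mp this
  rw [this]
  ring

variable [Fintype F]

theorem pow_eq_self_of_modEq {x : F} (hx : x ≠ 0) {j : ℕ}
    (hj : j ≡ 1 [MOD Fintype.card F - 1]) : x ^ j = x := by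
  rw [pow_eq_pow_of_modEq hj (FiniteField.pow_card_sub_one_eq_one x hx), pow_one]

theorem norm_mk_eq_prod {π : F[X]} (hm : π.Monic) [hπ : Fact (Irreducible π)] (a : F[X]) :
    algebraMap F (AlgebraicClosure F) (Algebra.norm F (AdjoinRoot.mk π a)) =
      ((π.aroots (AlgebraicClosure F)).map fun y => aeval y a).prod := by
  classical
  have h0 : π ≠ 0 := hm.ne_zero
  let pb := AdjoinRoot.powerBasis h0
  have hpb : pb.gen = AdjoinRoot.root π := AdjoinRoot.powerBasis_gen h0
  have hmin : minpoly F pb.gen = π := by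
    rw [AdjoinRoot.minpoly_powerBasis_gen_of_monic hm]
  have : FiniteDimensional F (AdjoinRoot π) := pb.finite
  rw [Algebra.norm_eq_prod_embeddings]
  rw [@Fintype.prod_equiv (AdjoinRoot π →ₐ[F] AlgebraicClosure F) _ _ _ _ _ pb.liftEquiv'
    (fun σ => σ (AdjoinRoot.mk π a)) (fun y => aeval (y : AlgebraicClosure F) a) ?_]
  · rw [Finset.prod_mem_multiset _ _ (fun y => aeval y a) (fun _ => rfl), hmin,
      Finset.prod_eq_multiset_prod, Multiset.toFinset_val, Multiset.dedup_eq_self.mpr]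
    exact nodup_roots (PerfectField.separable_of_irreducible hπ.out).map
  · intro σ
    rw [PowerBasis.liftEquiv'_apply_coe, hpb, aeval_algHom_apply, AdjoinRoot.aeval_eq]

theorem norm_mk_eq_resultant {π : F[X]} (hm : π.Monic) [hπ : Fact (Irreducible π)] (a : F[X]) :
    Algebra.norm F (AdjoinRoot.mk π a) = resultant π a π.natDegree a.natDegree := by
  apply (algebraMap F (AlgebraicClosure F)).injective
  rw [norm_mk_eq_prod hm, ← resultant_map_map]
  have := resultant_eq_prod_eval (π.map (algebraMap F (AlgebraicClosure F)))
    (a.map (algebraMap F (AlgebraicClosure F))) a.natDegree (by simp) (IsAlgClosed.splits _)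
  rw [natDegree_map, (hm.map _).leadingCoeff, one_pow, one_mul] at this
  rw [this, aroots_def]
  simp [eval_map_algebraMap]

/-- Dirichlet's theorem with a prescribed norm: in the progression `c₁ + a A` there are
irreducible `c` modulo which `a` has norm `1` over `F`. -/
theorem exists_irreducible_norm_one {a c₁ : F[X]} (ha : a ≠ 0)
    (had : a.natDegree ≡ 1 [MOD Fintype.card F - 1]) (hc : IsCoprime a c₁) {N : ℕ}
    (hN : 0 < N) (hqN : Fintype.card F - 1 ∣ N) (B : ℕ) :
    ∃ l : F[X], Irreducible (c₁ + l * a) ∧ (c₁ + l * a).natDegree ≡ 1 [MOD N] ∧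
      B < (c₁ + l * a).natDegree ∧ c₁ + l * a ∣
        a ^ (∑ i ∈ Finset.range (c₁ + l * a).natDegree, Fintype.card F ^ i) - 1 := by
  set κ := resultant a c₁ a.natDegree c₁.natDegree with hκ
  have hlc : a.leadingCoeff ≠ 0 := leadingCoeff_ne_zero.mpr ha
  have hκ0 : κ ≠ 0 := resultant_ne_zero _ _ hc
  set lam : F := -(a.leadingCoeff * κ) / a.leadingCoeff ^ c₁.natDegree with hlam
  have hlam0 : lam ≠ 0 := by
    rw [hlam]; exact div_ne_zero (neg_ne_zero.mpr (mul_ne_zero hlc hκ0)) (pow_ne_zero _ hlc)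
  have hunit : IsUnit (C lam⁻¹ : F[X]) := isUnit_C.mpr (inv_ne_zero hlam0).isUnit
  obtain ⟨π, hm, hi, hd, hdeg, hB⟩ := exists_irreducible_dvd_sub ha
    (c := C lam⁻¹ * c₁) ((isCoprime_mul_unit_left_right hunit _ _).mpr hc) hN B
  obtain ⟨e, he⟩ := hd
  have hCC : (C lam * C lam⁻¹ : F[X]) = 1 := by rw [← C_mul, mul_inv_cancel₀ hlam0, C_1]
  have hcπ : c₁ + C lam * e * a = C lam * π := by
    linear_combination (- C lam) * he + c₁ * hCC.symm
  have hnd : (C lam * π).natDegree = π.natDegree := natDegree_C_mul hlam0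
  refine ⟨C lam * e, ?_⟩
  rw [hcπ, hnd]
  have hassoc : Associated (C lam * π) π :=
    associated_unit_mul_left _ _ (isUnit_C.mpr hlam0.isUnit)
  refine ⟨hassoc.irreducible_iff.mpr hi, hdeg, hB, hassoc.dvd_iff_dvd_left.mpr ?_⟩
  have : Fact (Irreducible π) := ⟨hi⟩
  have hfin : Module.finrank F (AdjoinRoot π) = π.natDegree := by
    rw [(AdjoinRoot.powerBasis hm.ne_zero).finrank, AdjoinRoot.powerBasis_dim]
  have : FiniteDimensional F (AdjoinRoot π) := (AdjoinRoot.powerBasis hm.ne_zero).finite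
  have : Finite (AdjoinRoot π) := Module.finite_of_finite F
  have hpow := FiniteField.algebraMap_norm_eq_pow_sum (K := F) (x := AdjoinRoot.mk π a)
  rw [hfin, Nat.card_eq_fintype_card] at hpow
  have hjd : π.natDegree ≡ 1 [MOD Fintype.card F - 1] := hdeg.of_dvd hqN
  have hnorm : Algebra.norm F (AdjoinRoot.mk π a) = 1 := by
    rw [norm_mk_eq_resultant hm, resultant_comm,
      pow_eq_self_of_modEq (neg_ne_zero.mpr one_ne_zero) (by simpa using hjd.mul had)]
    have h1 := resultant_mul_resultant_eq (a := a) (c := c₁) (f := C lam * π)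
      ⟨C lam * e, by rw [← hcπ]; ring⟩
    rw [hnd, resultant_C_mul_right, pow_eq_self_of_modEq hlc hjd,
      pow_eq_self_of_modEq hlam0 had, ← hκ] at h1
    have h2 : lam * a.leadingCoeff ^ c₁.natDegree = -(a.leadingCoeff * κ) := by
      rw [hlam]; field_simp
    have h3 : a.leadingCoeff * κ ≠ 0 := mul_ne_zero hlc hκ0
    apply mul_left_cancel₀ h3
    linear_combination h1 - resultant a π a.natDegree π.natDegree * h2
  rw [hnorm, map_one] at hpow
  rw [← AdjoinRoot.mk_eq_zero, map_sub, map_pow, ← hpow, map_one, sub_self]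

end Norm

section Covering

variable {A : Type} [CommRing A]

/-- A function of the variables `v` that is given by a polynomial. -/
def IsPoly {σ : Type} (f : (σ → A) → A) : Prop :=
  ∃ P : MvPolynomial σ A, ∀ v, f v = MvPolynomial.eval v P

namespace IsPoly

variable {σ τ : Type} {f g : (σ → A) → A}

theorem const (a : A) : IsPoly fun _ : σ → A => a := ⟨MvPolynomial.C a, fun v => by simp⟩

theorem var (i : σ) : IsPoly fun v : σ → A => v i := ⟨MvPolynomial.X i, fun v => by simp⟩

theorem add (hf : IsPoly f) (hg : IsPoly g) : IsPoly fun v => f v + g v := by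
  obtain ⟨P, hP⟩ := hf
  obtain ⟨Q, hQ⟩ := hg
  exact ⟨P + Q, fun v => by simp [hP, hQ]⟩

theorem mul (hf : IsPoly f) (hg : IsPoly g) : IsPoly fun v => f v * g v := by
  obtain ⟨P, hP⟩ := hf
  obtain ⟨Q, hQ⟩ := hg
  exact ⟨P * Q, fun v => by simp [hP, hQ]⟩

theorem neg (hf : IsPoly f) : IsPoly fun v => -f v := by
  obtain ⟨P, hP⟩ := hf
  exact ⟨-P, fun v => by simp [hP]⟩

theorem sub (hf : IsPoly f) (hg : IsPoly g) : IsPoly fun v => f v - g v := by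
  simpa only [sub_eq_add_neg] using hf.add hg.neg

theorem pow (hf : IsPoly f) (k : ℕ) : IsPoly fun v => f v ^ k := by
  obtain ⟨P, hP⟩ := hf
  exact ⟨P ^ k, fun v => by simp [hP]⟩

theorem sum {ι : Type*} (s : Finset ι) {f : ι → (σ → A) → A} (hf : ∀ i, IsPoly (f i)) :
    IsPoly fun v => ∑ i ∈ s, f i v := by
  choose P hP using hf
  exact ⟨∑ i ∈ s, P i, fun v => by simp [hP]⟩

theorem comp (hf : IsPoly f) (e : σ → τ) : IsPoly fun v : τ → A => f fun i => v (e i) := by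
  obtain ⟨P, hP⟩ := hf
  exact ⟨MvPolynomial.rename e P,
    fun v => by simp [hP, MvPolynomial.eval_rename, Function.comp_def]⟩

end IsPoly

variable {ι : Type} [Fintype ι] [DecidableEq ι]

/-- A matrix-valued function all of whose entries are polynomial. -/
def IsPolyMat {σ κ : Type} (f : (σ → A) → Matrix κ κ A) : Prop :=
  ∀ i j, IsPoly fun v => f v i j

theorem IsPolyMat.const {σ κ : Type} (M : Matrix κ κ A) :
    IsPolyMat fun _ : σ → A => M := fun i j => IsPoly.const (M i j)

theorem IsPolyMat.comp {σ τ κ : Type} {f : (σ → A) → Matrix κ κ A} (hf : IsPolyMat f)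
    (e : σ → τ) : IsPolyMat fun v : τ → A => f fun i => v (e i) :=
  fun i j => (hf i j).comp e

theorem IsPolyMat.mul {σ κ : Type} [Fintype κ] {f g : (σ → A) → Matrix κ κ A}
    (hf : IsPolyMat f) (hg : IsPolyMat g) :
    IsPolyMat fun v => f v * g v := by
  intro i j
  simp only [Matrix.mul_apply]
  exact IsPoly.sum _ fun k => (hf i k).mul (hg k j)

theorem IsPolyMat.of_fin_two {σ : Type} {a b c d : (σ → A) → A} (ha : IsPoly a) (hb : IsPoly b)
    (hc : IsPoly c) (hd : IsPoly d) :
    IsPolyMat fun v => !![a v, b v; c v, d v] := by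
  intro i j
  fin_cases i <;> fin_cases j <;> assumption

/-- `X` is contained in the image of a polynomial map with at most `k` parameters whose values
are matrices of determinant one. -/
def Covered (k : ℕ) (X : Set (Matrix ι ι A)) : Prop :=
  ∃ (σ : Type) (_ : Fintype σ) (f : (σ → A) → Matrix ι ι A), Fintype.card σ ≤ k ∧
    IsPolyMat f ∧ (∀ v, (f v).det = 1) ∧ X ⊆ Set.range f

namespace Covered

variable {k l : ℕ} {X Y Z : Set (Matrix ι ι A)}

theorem mono (h : Covered k X) (hkl : k ≤ l) (hYX : Y ⊆ X) : Covered l Y := by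
  obtain ⟨σ, _, f, hc, hf, hd, hX⟩ := h
  exact ⟨σ, _, f, hc.trans hkl, hf, hd, hYX.trans hX⟩

theorem mul (hX : Covered k X) (hY : Covered l Y)
    (hZ : ∀ z ∈ Z, ∃ x ∈ X, ∃ y ∈ Y, z = x * y) : Covered (k + l) Z := by
  obtain ⟨σ, _, f, hfc, hf, hfd, hfX⟩ := hX
  obtain ⟨τ, _, g, hgc, hg, hgd, hgY⟩ := hY
  refine ⟨σ ⊕ τ, inferInstance, fun v => f (fun i => v (.inl i)) * g (fun i => v (.inr i)),
    by rw [Fintype.card_sum]; omega, (hf.comp _).mul (hg.comp _),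
    fun v => by rw [Matrix.det_mul, hfd, hgd, one_mul], fun z hz => ?_⟩
  obtain ⟨x, hx, y, hy, rfl⟩ := hZ z hz
  obtain ⟨v, rfl⟩ := hfX hx
  obtain ⟨w, rfl⟩ := hgY hy
  exact ⟨Sum.elim v w, rfl⟩

theorem sandwich {σ : Type} [Fintype σ] {L R : (σ → A) → Matrix ι ι A} (hL : IsPolyMat L)
    (hR : IsPolyMat R) (hLd : ∀ v, (L v).det = 1) (hRd : ∀ v, (R v).det = 1)
    (hX : Covered k X) (hZ : ∀ z ∈ Z, ∃ v, ∃ x ∈ X, z = L v * x * R v) :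
    Covered (Fintype.card σ + k) Z := by
  obtain ⟨τ, _, f, hfc, hf, hfd, hfX⟩ := hX
  refine ⟨σ ⊕ τ, inferInstance,
    fun v => L (fun i => v (.inl i)) * f (fun i => v (.inr i)) * R (fun i => v (.inl i)),
    by rw [Fintype.card_sum]; omega, ((hL.comp _).mul (hf.comp _)).mul (hR.comp _),
    fun v => by rw [Matrix.det_mul, Matrix.det_mul, hLd, hfd, hRd, one_mul, one_mul],
    fun z hz => ?_⟩
  obtain ⟨v, x, hx, rfl⟩ := hZ z hz
  obtain ⟨w, rfl⟩ := hfX hx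
  exact ⟨Sum.elim v w, rfl⟩

theorem transpose (hX : Covered k X) (hZ : ∀ z ∈ Z, z.transpose ∈ X) : Covered k Z := by
  obtain ⟨σ, _, f, hc, hf, hd, hfX⟩ := hX
  refine ⟨σ, _, fun v => (f v).transpose, hc, fun i j => hf j i,
    fun v => by rw [Matrix.det_transpose, hd], fun z hz => ?_⟩
  obtain ⟨v, hv⟩ := hfX (hZ z hz)
  exact ⟨v, by simp [hv]⟩

theorem adjugate_fin_two {X Z : Set (Matrix (Fin 2) (Fin 2) A)} (hX : Covered k X)
    (hZ : ∀ z ∈ Z, ∃ x ∈ X, z = x.adjugate) : Covered k Z := by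
  obtain ⟨σ, _, f, hc, hf, hd, hfX⟩ := hX
  refine ⟨σ, _, fun v => (f v).adjugate, hc, ?_, fun v => ?_, fun z hz => ?_⟩
  · simp only [Matrix.adjugate_fin_two]
    exact .of_fin_two (hf 1 1) (hf 0 1).neg (hf 1 0).neg (hf 0 0)
  · rw [Matrix.det_adjugate, hd, one_pow]
  · obtain ⟨x, hx, rfl⟩ := hZ z hz
    obtain ⟨v, rfl⟩ := hfX hx
    exact ⟨v, rfl⟩

/-- A covered set consisting of matrices of determinant one, and containing all of them, is a
polynomial family. -/
theorem exists_range_eq (hX : Covered k {M : Matrix ι ι A | M.det = 1}) :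
    ∃ P : ι → ι → MvPolynomial (Fin k) A, {M : Matrix ι ι A | M.det = 1} =
      Set.range fun v : Fin k → A => Matrix.of fun i j => MvPolynomial.eval v (P i j) := by
  obtain ⟨σ, _, f, hc, hf, hd, hfX⟩ := hX
  obtain ⟨e⟩ : Nonempty (σ ↪ Fin k) := Function.Embedding.nonempty_of_card_le (by simpa using hc)
  choose P hP using fun i j => (hf i j).comp e
  have hfP : ∀ v : Fin k → A, (Matrix.of fun i j => MvPolynomial.eval v (P i j)) =
      f fun i => v (e i) := by
    intro v
    ext1 i j
    exact (hP i j v).symm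
  refine ⟨P, Set.Subset.antisymm (fun M hM => ?_) ?_⟩
  · obtain ⟨v, rfl⟩ := hfX hM
    refine ⟨Function.extend e v 0, ?_⟩
    simp only [hfP, e.injective.extend_apply]
  · rintro _ ⟨v, rfl⟩
    simp only [hfP, Set.mem_ofPred_eq, hd]

end Covered

end Covering

section FinTwo

variable {A : Type}

theorem matrix_fin_two_congr {a b c d a' b' c' d' : A} (ha : a = a') (hb : b = b') (hc : c = c')
    (hd : d = d') : !![a, b; c, d] = !![a', b'; c', d'] := by
  rw [ha, hb, hc, hd]

variable [CommRing A]

/-- The upper elementary matrix. -/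
def upper (x : A) : Matrix (Fin 2) (Fin 2) A := !![1, x; 0, 1]

/-- The lower elementary matrix. -/
def lower (x : A) : Matrix (Fin 2) (Fin 2) A := !![1, 0; x, 1]

theorem det_upper (x : A) : (upper x).det = 1 := by simp [upper]

theorem det_lower (x : A) : (lower x).det = 1 := by simp [lower]

theorem isPolyMat_upper {σ : Type} {f : (σ → A) → A} (hf : IsPoly f) :
    IsPolyMat fun v => upper (f v) :=
  .of_fin_two (.const 1) hf (.const 0) (.const 1)

theorem isPolyMat_lower {σ : Type} {f : (σ → A) → A} (hf : IsPoly f) :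
    IsPolyMat fun v => lower (f v) :=
  .of_fin_two (.const 1) (.const 0) hf (.const 1)

/-- Two matrices of determinant one with the same second row differ by an upper elementary
matrix. -/
theorem eq_upper_mul {a b c d a' b' : A} (h : a * d - b * c = 1) (h' : a' * d - b' * c = 1) :
    !![a, b; c, d] = upper (b * a' - a * b') * !![a', b'; c, d] := by
  rw [upper, Matrix.mul_fin_two]
  apply matrix_fin_two_congr
  · linear_combination a' * h - a * h'
  · linear_combination b' * h - b * h'
  · ring
  · ring

theorem eq_lower_mul {a b c d c' d' : A} (h : a * d - b * c = 1) (h' : a * d' - b * c' = 1) :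
    !![a, b; c, d] = lower (c * d' - d * c') * !![a, b; c', d'] := by
  rw [lower, Matrix.mul_fin_two]
  apply matrix_fin_two_congr
  · ring
  · ring
  · linear_combination c' * h - c * h'
  · linear_combination d' * h - d * h'

/-- A unimodular matrix depending polynomially on three free parameters. -/
def cubicUpper (e p c : A) : Matrix (Fin 2) (Fin 2) A :=
  !![1 - e * p * c + (e * p * c) ^ 2, -(p ^ 3 * c); -(e ^ 3 * c ^ 2), 1 + e * p * c]

theorem det_cubicUpper (e p c : A) : (cubicUpper e p c).det = 1 := by
  rw [cubicUpper, Matrix.det_fin_two_of]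
  ring

theorem isPolyMat_cubicUpper {σ : Type} {e p c : (σ → A) → A} (he : IsPoly e) (hp : IsPoly p)
    (hc : IsPoly c) : IsPolyMat fun v => cubicUpper (e v) (p v) (c v) := by
  have hw := (he.mul hp).mul hc
  exact .of_fin_two (((IsPoly.const 1).sub hw).add (hw.pow 2)) ((hp.pow 3).mul hc).neg
    ((he.pow 3).mul (hc.pow 2)).neg ((IsPoly.const 1).add hw)

theorem exists_eq_upper_mul_mul {a b c d m n o r t u v w : A} (h : a * d - b * c = 1)
    (h₁ : m * r - n * o = 1) (h₂ : t * w - u * v = 1) (hv : c * r - d * o = v)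
    (hw : d * m - c * n = w) :
    ∃ k, !![a, b; c, d] = upper k * !![t, u; v, w] * !![m, n; o, r] := by
  have hc : c = v * m + w * o := by linear_combination m * hv + o * hw - c * h₁
  have hd : d = v * n + w * r := by linear_combination n * hv + r * hw - d * h₁
  have hdet : (t * m + u * o) * d - (t * n + u * r) * c = 1 := by
    rw [hc, hd]
    linear_combination (m * r - n * o) * h₂ + h₁
  refine ⟨b * (t * m + u * o) - a * (t * n + u * r), (eq_upper_mul h hdet).trans ?_⟩
  rw [Matrix.mul_assoc, Matrix.mul_fin_two, ← hc, ← hd]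

theorem conj_eq_of_sq {e x y z : A} (h : e ^ 2 * z - x * y = 1) :
    ∃ k, !![1 + 2 * x * y, 2 * e ^ 2 * x; 2 * y * z, 1 + 2 * x * y] =
      upper (1 - e) * lower (-1) * upper 1 * (upper k *
        cubicUpper e (1 + 2 * x * y - 2 * e * x) (2 * y * z - 2 * x) *
        (lower (y + e) * upper (2 * x) * lower (y - e))) *
        (upper (-1) * lower 1 * upper (e - 1)) := by
  obtain ⟨k, hk⟩ := exists_eq_upper_mul_mul (a := 1 + 2 * x * y - e * (2 * y * z))
    (b := -(2 * y * z)) (c := e ^ 2 * (2 * y * z - 2 * x))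
    (d := 1 + 2 * x * y + e * (2 * y * z)) (m := 1 + 2 * x * (y - e)) (n := 2 * x)
    (o := (y + e) * (1 + 2 * x * (y - e)) + (y - e)) (r := 1 + 2 * x * (y + e))
    (t := 1 - e * (1 + 2 * x * y - 2 * e * x) * (2 * y * z - 2 * x) +
      (e * (1 + 2 * x * y - 2 * e * x) * (2 * y * z - 2 * x)) ^ 2)
    (u := -((1 + 2 * x * y - 2 * e * x) ^ 3 * (2 * y * z - 2 * x)))
    (v := -(e ^ 3 * (2 * y * z - 2 * x) ^ 2))
    (w := 1 + e * (1 + 2 * x * y - 2 * e * x) * (2 * y * z - 2 * x))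
    (by grind) (by ring) (by ring) (by grind) (by grind)
  refine ⟨k, ?_⟩
  have hlow : lower (y + e) * upper (2 * x) * lower (y - e) =
      !![1 + 2 * x * (y - e), 2 * x; (y + e) * (1 + 2 * x * (y - e)) + (y - e),
        1 + 2 * x * (y + e)] := by
    simp only [lower, upper, Matrix.mul_fin_two]
    apply matrix_fin_two_congr <;> ring
  rw [hlow, cubicUpper, ← hk]
  simp only [lower, upper, Matrix.mul_fin_two]
  apply matrix_fin_two_congr
  · ring
  · ring
  · ring
  · ring

/-- The commutator of a matrix of determinant one with `diag(1, -1)`. -/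
def signComm (a b c d : A) : Matrix (Fin 2) (Fin 2) A :=
  !![a * d + b * c, 2 * a * b; 2 * c * d, a * d + b * c]

theorem signComm_eq_upper (a b c d t : A) :
    signComm a b c d = upper (-t) * signComm (a + t * c) (b + t * d) c d * upper (-t) := by
  simp only [signComm, upper, Matrix.mul_fin_two]
  apply matrix_fin_two_congr <;> ring

theorem signComm_eq_lower (a b c d t : A) :
    signComm a b c d = lower (-t) * signComm a b (c + t * a) (d + t * b) * lower (-t) := by
  simp only [signComm, lower, Matrix.mul_fin_two]
  apply matrix_fin_two_congr <;> ring

theorem covered_signComm_sq :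
    Covered 5 {M : Matrix (Fin 2) (Fin 2) A |
      ∃ e x y z, e ^ 2 * z - x * y = 1 ∧ M = signComm (e ^ 2) x y z} := by
  have e : IsPoly fun v : Fin 5 → A => v 0 := .var 0
  have x : IsPoly fun v : Fin 5 → A => v 1 := .var 1
  have y : IsPoly fun v : Fin 5 → A => v 2 := .var 2
  have z : IsPoly fun v : Fin 5 → A => v 3 := .var 3
  have k : IsPoly fun v : Fin 5 → A => v 4 := .var 4
  have one : IsPoly fun _ : Fin 5 → A => (1 : A) := .const 1
  have two : IsPoly fun _ : Fin 5 → A => (2 : A) := .const 2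
  refine ⟨Fin 5, inferInstance, fun v => upper (1 - v 0) * lower (-1) * upper 1 * (upper (v 4) *
        cubicUpper (v 0) (1 + 2 * v 1 * v 2 - 2 * v 0 * v 1) (2 * v 2 * v 3 - 2 * v 1) *
        (lower (v 2 + v 0) * upper (2 * v 1) * lower (v 2 - v 0))) *
        (upper (-1) * lower 1 * upper (v 0 - 1)), by simp, ?_, fun v => ?_, ?_⟩
  · exact ((((isPolyMat_upper (one.sub e)).mul (.const _)).mul (.const _)).mul
      (((isPolyMat_upper k).mul (isPolyMat_cubicUpper e
        ((one.add ((two.mul x).mul y)).sub ((two.mul e).mul x))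
        (((two.mul y).mul z).sub (two.mul x)))).mul (((isPolyMat_lower (y.add e)).mul
          (isPolyMat_upper (two.mul x))).mul (isPolyMat_lower (y.sub e))))).mul
      (((IsPolyMat.const _).mul (.const _)).mul (isPolyMat_upper (e.sub one)))
  · simp only [Matrix.det_mul, det_upper, det_lower, det_cubicUpper, mul_one]
  · rintro _ ⟨e, x, y, z, h, rfl⟩
    obtain ⟨k, hk⟩ := conj_eq_of_sq h
    refine ⟨![e, x, y, z, k], ?_⟩
    refine Eq.trans ?_ (hk.symm.trans ?_)
    · rfl
    · rw [signComm, show e ^ 2 * z + x * y = 1 + 2 * x * y by linear_combination h]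

/-- A unimodular matrix depending polynomially on four free parameters. -/
def cubicLower (h b f y : A) : Matrix (Fin 2) (Fin 2) A :=
  !![1 + h * b * f * y, -(b ^ 3 * f ^ 2 * y);
    -(h ^ 3 * f * y ^ 2), 1 - h * b * f * y + (h * b * f * y) ^ 2]

theorem det_cubicLower (h b f y : A) : (cubicLower h b f y).det = 1 := by
  rw [cubicLower, Matrix.det_fin_two_of]
  ring

theorem isPolyMat_cubicLower {σ : Type} {h b f y : (σ → A) → A} (hh : IsPoly h) (hb : IsPoly b)
    (hf : IsPoly f) (hy : IsPoly y) :
    IsPolyMat fun v => cubicLower (h v) (b v) (f v) (y v) := by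
  have hw := ((hh.mul hb).mul hf).mul hy
  exact .of_fin_two ((IsPoly.const 1).add hw) (((hb.pow 3).mul (hf.pow 2)).mul hy).neg
    (((hh.pow 3).mul hf).mul (hy.pow 2)).neg (((IsPoly.const 1).sub hw).add (hw.pow 2))

/-- The matrices of determinant one with equal diagonal entries. -/
def equalDiag (A : Type) [CommRing A] : Set (Matrix (Fin 2) (Fin 2) A) :=
  {M | ∃ h b c, h * h - b * c = 1 ∧ M = !![h, b; c, h]}

/-- The matrices of determinant one of the form `h + f N`, where `N` has trace zero and its upper
right entry divides `f`, up to the lower left entry. -/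
def almostScalar (A : Type) [CommRing A] : Set (Matrix (Fin 2) (Fin 2) A) :=
  {M | ∃ h b f y c, (h + b * f * y) * (h - b * f * y) - b ^ 2 * f * c = 1 ∧
    M = !![h + b * f * y, b ^ 2 * f; c, h - b * f * y]}

theorem covered_almostScalar {k : ℕ} (hk : Covered k (equalDiag A)) :
    Covered (5 + k) (almostScalar A) := by
  refine Covered.sandwich (σ := Fin 5)
    (L := fun v => lower (v 0) * cubicLower (v 1) (v 2) (v 3) (v 4)) (R := fun _ => 1)
    ((isPolyMat_lower (.var 0)).mul (isPolyMat_cubicLower (.var 1) (.var 2) (.var 3) (.var 4)))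
    (.const 1) (fun v => by rw [Matrix.det_mul, det_lower, det_cubicLower, mul_one])
    (fun v => Matrix.det_one) hk ?_
  rintro _ ⟨h, b, f, y, c, hdet, rfl⟩
  have hg : h * h - b ^ 2 * f * (c + f * y ^ 2) = 1 := by linear_combination hdet
  have hmul : cubicLower h b f y * !![h, b ^ 2 * f; c + f * y ^ 2, h] =
      !![h + b * f * y, b ^ 2 * f; -(h ^ 3 * f * y ^ 2) * h +
        (1 - h * b * f * y + (h * b * f * y) ^ 2) * (c + f * y ^ 2), -(h ^ 3 * f * y ^ 2) *
        (b ^ 2 * f) + (1 - h * b * f * y + (h * b * f * y) ^ 2) * h] := by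
    rw [cubicLower, Matrix.mul_fin_two]
    apply matrix_fin_two_congr
    · linear_combination b * f * y * hdet
    · ring
    · rfl
    · rfl
  have hdet' := congrArg Matrix.det hmul
  rw [Matrix.det_mul, det_cubicLower, Matrix.det_fin_two_of, Matrix.det_fin_two_of, hg,
    one_mul] at hdet'
  have hX := eq_lower_mul hdet hdet'.symm
  rw [← hmul] at hX
  exact ⟨![_, h, b, f, y], _, ⟨h, _, _, hg, rfl⟩,
    hX.trans (by simp only [Matrix.mul_one, Matrix.mul_assoc]; rfl)⟩

theorem covered_almostScalar_transpose {k : ℕ} (hk : Covered k (almostScalar A)) :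
    Covered k {M | M.transpose ∈ almostScalar A} :=
  hk.transpose fun _ hz => hz

end FinTwo

section EqualDiag

theorem exists_eq_signComm {A : Type} [CommRing A] [IsDomain A] [DecompositionMonoid A]
    (h2 : IsUnit (2 : A)) {h b c : A} (hdet : h * h - b * c = 1) :
    ∃ x y z w : A, x * w - y * z = 1 ∧ !![h, b; c, h] = signComm x y z w := by
  obtain ⟨t, ht⟩ := h2.exists_right_inv
  have hrel : (t * (h + 1)) * (t * (h - 1)) = (t * b) * (t * c) := by
    linear_combination t ^ 2 * hdet
  have hdiff : t * (h + 1) - t * (h - 1) = 1 := by linear_combination ht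
  suffices H : ∃ x y z w : A, x * w = t * (h + 1) ∧ y * z = t * (h - 1) ∧
      x * y = t * b ∧ z * w = t * c by
    obtain ⟨x, y, z, w, h1, h3, h4, h5⟩ := H
    refine ⟨x, y, z, w, by rw [h1, h3, hdiff], ?_⟩
    rw [signComm, mul_assoc 2, mul_assoc 2, h1, h3, h4, h5]
    apply matrix_fin_two_congr
    · linear_combination (-h) * ht
    · linear_combination (-b) * ht
    · linear_combination (-c) * ht
    · linear_combination (-h) * ht
  by_cases hu : t * (h + 1) = 0
  · have hv : t * (h - 1) ≠ 0 := fun hv => by simp [hu, hv] at hdiff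
    obtain ⟨y, z, ⟨x, hx⟩, ⟨w, hw⟩, hyz⟩ :=
      exists_dvd_and_dvd_of_dvd_mul (Dvd.intro_left _ hrel)
    refine ⟨x, y, z, w, mul_right_cancel₀ hv ?_, hyz.symm, by rw [hx, mul_comm], hw.symm⟩
    rw [hrel, hx, hw, hyz]
    ring
  · obtain ⟨x, w, ⟨y, hy⟩, ⟨z, hz⟩, hxw⟩ :=
      exists_dvd_and_dvd_of_dvd_mul (Dvd.intro _ hrel)
    refine ⟨x, y, z, w, hxw.symm, mul_left_cancel₀ hu ?_, hy.symm, by rw [hz, mul_comm]⟩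
    rw [hrel, hy, hz, hxw]
    ring

variable {F : Type} [Field F]

theorem exists_natDegree_add_mul (N : ℕ) (hN : 0 < N) (x : F[X]) {c : F[X]} (hc : c ≠ 0) :
    ∃ k : F[X], (x + k * c).natDegree ≡ 1 [MOD N] ∧ 0 < (x + k * c).natDegree := by
  set e := 1 + c.natDegree * (N - 1) + N * (x.natDegree + 1) with he
  have hdeg : (X ^ e * c : F[X]).natDegree = 1 + N * (c.natDegree + x.natDegree + 1) := by
    rw [natDegree_X_pow_mul _ hc, he]
    obtain ⟨M, rfl⟩ : ∃ M, N = M + 1 := ⟨N - 1, by omega⟩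
    simp only [Nat.add_sub_cancel]
    ring
  have hlt : x.natDegree < (X ^ e * c : F[X]).natDegree := by
    rw [hdeg]
    nlinarith
  refine ⟨X ^ e, ?_, ?_⟩
  · rw [natDegree_add_eq_right_of_natDegree_lt hlt, hdeg]
    simp [Nat.ModEq]
  · rw [natDegree_add_eq_right_of_natDegree_lt hlt]
    omega

variable [Fintype F]

theorem exists_sq_sub_dvd (hq : Odd (Fintype.card F)) {a c : F[X]} (hc : Irreducible c)
    (h : c ∣ a ^ (∑ i ∈ Finset.range c.natDegree, Fintype.card F ^ i) - 1) :
    ∃ e, c ∣ e ^ 2 - a := by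
  have : Fact (Irreducible c) := ⟨hc⟩
  have hfin : Module.finrank F (AdjoinRoot c) = c.natDegree := by
    rw [(AdjoinRoot.powerBasis hc.ne_zero).finrank, AdjoinRoot.powerBasis_dim]
  have : FiniteDimensional F (AdjoinRoot c) := (AdjoinRoot.powerBasis hc.ne_zero).finite
  have : Finite (AdjoinRoot c) := Module.finite_of_finite F
  have : Fintype (AdjoinRoot c) := Fintype.ofFinite _
  have hcard : Fintype.card (AdjoinRoot c) = Fintype.card F ^ c.natDegree := by
    rw [Module.card_eq_pow_finrank (K := F), hfin]
  rw [← AdjoinRoot.mk_eq_zero, map_sub, map_pow, map_one, sub_eq_zero] at h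
  obtain ⟨s, hs⟩ := hq
  have hgeom : (∑ i ∈ Finset.range c.natDegree, Fintype.card F ^ i) * s =
      Fintype.card F ^ c.natDegree / 2 := by
    have h1 := geom_sum_mul_add (2 * s) c.natDegree
    rw [← hs] at h1
    rw [← h1, mul_left_comm]
    omega
  have hnz : AdjoinRoot.mk c a ≠ 0 := by
    intro h0
    rw [h0, zero_pow] at h
    · exact zero_ne_one h
    · refine (Finset.sum_pos (fun i _ => pow_pos Fintype.card_pos i) ?_).ne'
      simpa using (hc.natDegree_pos).ne'
  have hsq : IsSquare (AdjoinRoot.mk c a) := by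
    rw [FiniteField.isSquare_iff _ hnz, hcard, ← hgeom, pow_mul, h, one_pow]
    intro h2
    have heven := FiniteField.even_card_of_char_two h2
    have hodd : Odd (Fintype.card (AdjoinRoot c)) := hcard ▸ Odd.pow ⟨s, hs⟩
    rw [Nat.odd_iff] at hodd
    omega
  obtain ⟨r, hr⟩ := hsq
  obtain ⟨e, rfl⟩ := AdjoinRoot.mk_surjective r
  refine ⟨e, ?_⟩
  rw [← AdjoinRoot.mk_eq_zero, map_sub, map_pow, hr, pow_two, sub_self]

theorem exists_square_of_isCoprime (hq : Odd (Fintype.card F)) {x y : F[X]}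
    (h : IsCoprime x y) : ∃ s k l m e : F[X],
      x + k * (y + s * x) + m * (y + s * x + l * (x + k * (y + s * x))) = e ^ 2 := by
  obtain ⟨s, hs⟩ : ∃ s : F[X], y + s * x ≠ 0 := by
    by_cases hy : y = 0
    · refine ⟨1, ?_⟩
      rintro h0
      have : x = 0 := by simpa [hy] using h0
      rw [hy, this, isCoprime_zero_left] at h
      exact not_isUnit_zero h
    · exact ⟨0, by simpa using hy⟩
  have hq1 : 0 < Fintype.card F - 1 := Nat.sub_pos_of_lt Fintype.one_lt_card
  obtain ⟨k, hk, hk0⟩ := exists_natDegree_add_mul _ hq1 x hs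
  have hcop : IsCoprime (x + k * (y + s * x)) (y + s * x) :=
    IsCoprime.add_mul_right_left (IsCoprime.add_mul_right_right h s) k
  obtain ⟨l, hirr, -, -, hdvd⟩ := exists_irreducible_norm_one (ne_zero_of_natDegree_gt hk0) hk
    hcop hq1 dvd_rfl 0
  obtain ⟨e, m, hm⟩ := exists_sq_sub_dvd hq hirr hdvd
  exact ⟨s, k, l, m, e, by linear_combination -hm⟩

theorem isUnit_two (hq : Odd (Fintype.card F)) : IsUnit (2 : F[X]) := by
  have : (2 : F) ≠ 0 := Ring.two_ne_zero (by
    intro h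
    have := FiniteField.even_card_of_char_two h
    rw [Nat.odd_iff] at hq
    omega)
  exact isUnit_C.mpr this.isUnit

theorem covered_equalDiag (hq : Odd (Fintype.card F)) : Covered 9 (equalDiag F[X]) := by
  have hL : IsPolyMat fun v : Fin 4 → F[X] =>
      lower (-v 0) * upper (-v 1) * lower (-v 2) * upper (-v 3) :=
    (((isPolyMat_lower (IsPoly.var 0).neg).mul (isPolyMat_upper (IsPoly.var 1).neg)).mul
      (isPolyMat_lower (IsPoly.var 2).neg)).mul (isPolyMat_upper (IsPoly.var 3).neg)
  have hR : IsPolyMat fun v : Fin 4 → F[X] =>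
      upper (-v 3) * lower (-v 2) * upper (-v 1) * lower (-v 0) :=
    (((isPolyMat_upper (IsPoly.var 3).neg).mul (isPolyMat_lower (IsPoly.var 2).neg)).mul
      (isPolyMat_upper (IsPoly.var 1).neg)).mul (isPolyMat_lower (IsPoly.var 0).neg)
  refine Covered.sandwich hL hR
    (fun v => by simp only [Matrix.det_mul, det_upper, det_lower, mul_one])
    (fun v => by simp only [Matrix.det_mul, det_upper, det_lower, mul_one])
    covered_signComm_sq ?_
  rintro _ ⟨h, b, c, hdet, rfl⟩
  obtain ⟨x, y, z, w, hxw, hZ⟩ := exists_eq_signComm (isUnit_two hq) hdet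
  obtain ⟨s, k, l, m, e, he⟩ := exists_square_of_isCoprime hq (x := x) (y := z)
    ⟨w, -y, by linear_combination hxw⟩
  rw [hZ, signComm_eq_lower _ _ _ _ s, signComm_eq_upper _ _ _ _ k, signComm_eq_lower _ _ _ _ l,
    signComm_eq_upper _ _ _ _ m, he]
  refine ⟨![s, k, l, m], _, ⟨e, y + k * (w + s * y) + m * (w + s * y + l * (y + k * (w + s * y))),
    z + s * x + l * (x + k * (z + s * x)), w + s * y + l * (y + k * (w + s * y)), ?_, rfl⟩, ?_⟩
  · rw [← he]
    linear_combination hxw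
  · simp only [Matrix.mul_assoc]
    rfl

end EqualDiag

section Powers

variable {A : Type} [CommRing A] {α X Y Z : Matrix (Fin 2) (Fin 2) A} {b c : A}

/-- `Y` is a combination `f α + g` with `f` divisible by `b`. -/
def InSpan (α : Matrix (Fin 2) (Fin 2) A) (b : A) (Y : Matrix (Fin 2) (Fin 2) A) : Prop :=
  ∃ f g : A, b ∣ f ∧ Y = f • α + g • 1

theorem lin_mul_lin (hα : α.det = 1) (f g f' g' : A) :
    (f • α + g • 1) * (f' • α + g' • 1) =
      (f * f' * (α 0 0 + α 1 1) + f * g' + f' * g) • α + (g * g' - f * f') • 1 := by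
  rw [Matrix.det_fin_two] at hα
  ext i j
  fin_cases i <;> fin_cases j <;> simp [Matrix.mul_apply, Fin.sum_univ_two] <;>
    [linear_combination (-f * f') * hα; ring; ring; linear_combination (-f * f') * hα]

theorem InSpan.one : InSpan α b 1 := ⟨0, 1, dvd_zero b, by simp⟩

theorem InSpan.self : InSpan α 1 α := ⟨1, 0, one_dvd _, by simp⟩

theorem InSpan.mul (hα : α.det = 1) (hY : InSpan α b Y) (hZ : InSpan α b Z) :
    InSpan α b (Y * Z) := by
  obtain ⟨f, g, hf, rfl⟩ := hY
  obtain ⟨f', g', hf', rfl⟩ := hZ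
  refine ⟨_, _, ?_, lin_mul_lin hα f g f' g'⟩
  exact dvd_add (dvd_add ((hf.mul_right _).mul_right _) (hf.mul_right _)) (hf'.mul_right _)

theorem InSpan.pow (hα : α.det = 1) (hY : InSpan α b Y) (k : ℕ) : InSpan α b (Y ^ k) := by
  induction k with
  | zero => simpa using InSpan.one
  | succ k ih => rw [pow_succ]; exact ih.mul hα hY

theorem InSpan.trans (hX : InSpan α 1 X) (hY : InSpan X b Y) : InSpan α b Y := by
  obtain ⟨f, g, -, rfl⟩ := hX
  obtain ⟨f', g', hf', rfl⟩ := hY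
  refine ⟨f' * f, f' * g + g', hf'.mul_right _, ?_⟩
  module

theorem inSpan_pow_of_trace (hX : X.det = 1) (ht : b ∣ X 0 0 + X 1 1 - 2) {p : ℕ}
    (hp : (p : A) = 0) : InSpan X b (X ^ p) := by
  have key : ∀ k : ℕ, ∃ f g : A, b ∣ f - k ∧ b ∣ g - (1 - k) ∧ X ^ k = f • X + g • 1 := by
    intro k
    induction k with
    | zero => exact ⟨0, 1, by simp, by simp, by simp⟩
    | succ k ih =>
      obtain ⟨f, g, hf, hg, hk⟩ := ih
      refine ⟨f * (X 0 0 + X 1 1) + g, -f, ?_, ?_, ?_⟩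
      · convert dvd_add (dvd_add (ht.mul_left f) (hf.mul_left 2)) hg using 1
        push_cast
        ring
      · convert (dvd_neg.mpr hf) using 1
        push_cast
        ring
      · rw [pow_succ, hk]
        have := lin_mul_lin hX f g 1 0
        simpa using this
  obtain ⟨f, g, hf, -, h⟩ := key p
  exact ⟨f, g, by simpa [hp] using hf, h⟩

theorem dvd_pow_entries (hb : b ∣ α 0 1) (k : ℕ) :
    b ∣ (α ^ k) 0 1 ∧ b ∣ (α ^ k) 0 0 - α 0 0 ^ k := by
  induction k with
  | zero => simp
  | succ k ih =>
    rw [pow_succ, Matrix.mul_apply, Matrix.mul_apply, Fin.sum_univ_two, Fin.sum_univ_two]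
    refine ⟨dvd_add (hb.mul_left _) (ih.1.mul_right _), ?_⟩
    convert dvd_add (ih.2.mul_right (α 0 0)) (ih.1.mul_right (α 1 0)) using 1
    ring

theorem dvd_pow_diag_sub_one (hα : α.det = 1) (hb : b ∣ α 0 1) {k : ℕ}
    (hk : b ∣ α 0 0 ^ k - 1) : b ∣ (α ^ k) 0 0 - 1 ∧ b ∣ (α ^ k) 1 1 - 1 := by
  obtain ⟨h1, h2⟩ := dvd_pow_entries hb k
  have h3 : b ∣ (α ^ k) 0 0 - 1 := by simpa using dvd_add h2 hk
  refine ⟨h3, ?_⟩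
  have hd : (α ^ k).det = 1 := by rw [Matrix.det_pow, hα, one_pow]
  rw [Matrix.det_fin_two] at hd
  have := dvd_sub (h1.mul_right ((α ^ k) 1 0)) (h3.mul_right ((α ^ k) 1 1))
  convert this using 1
  linear_combination hd

theorem inSpan_pow_mul (hα : α.det = 1) (hb : b ∣ α 0 1) {m p : ℕ} (hm : b ∣ α 0 0 ^ m - 1)
    (hp : (p : A) = 0) : InSpan α b (α ^ (m * p)) := by
  rw [pow_mul]
  refine (InSpan.self.pow hα m).trans (inSpan_pow_of_trace ?_ ?_ hp)
  · rw [Matrix.det_pow, hα, one_pow]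
  · obtain ⟨h1, h2⟩ := dvd_pow_diag_sub_one hα hb hm
    convert dvd_add h1 h2 using 1
    ring

theorem inSpan_pow_of_prime (hα : α.det = 1) (hb : b ∣ α 0 1) (hprime : Prime b) {n : ℕ}
    (hn : b ∣ α 0 0 ^ n - 1) (ha : ¬ b ∣ α 0 0 ^ 2 - 1) : InSpan α b (α ^ n) := by
  obtain ⟨f, g, -, h⟩ := InSpan.self.pow hα n
  refine ⟨f, g, ?_, h⟩
  obtain ⟨h1, h2⟩ := dvd_pow_diag_sub_one hα hb hn
  have h3 : b ∣ f * (α 0 0 - α 1 1) := by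
    convert dvd_sub h1 h2 using 1
    rw [h]
    simp
    ring
  refine (hprime.dvd_or_dvd h3).resolve_right fun h4 => ha ?_
  rw [Matrix.det_fin_two] at hα
  convert dvd_add (h4.mul_left (α 0 0)) (hb.mul_right (α 1 0)) using 1
  linear_combination hα

theorem InSpan.mem_almostScalar (h2 : IsUnit (2 : A)) (hY : InSpan α (α 0 1) Y)
    (hd : Y.det = 1) : Y ∈ almostScalar A := by
  obtain ⟨t, ht⟩ := h2.exists_right_inv
  obtain ⟨f, g, ⟨e, rfl⟩, rfl⟩ := hY
  have hmat : (α 0 1 * e) • α + g • 1 =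
      !![g + α 0 1 * e * t * (α 0 0 + α 1 1) + α 0 1 * e * (t * (α 0 0 - α 1 1)),
        α 0 1 ^ 2 * e; α 0 1 * e * α 1 0,
        g + α 0 1 * e * t * (α 0 0 + α 1 1) - α 0 1 * e * (t * (α 0 0 - α 1 1))] := by
    ext i j
    fin_cases i <;> fin_cases j <;> simp
    · linear_combination (-α 0 1 * e * α 0 0) * ht
    · ring
    · linear_combination (-α 0 1 * e * α 1 1) * ht
  rw [hmat] at hd ⊢
  rw [Matrix.det_fin_two_of] at hd
  exact ⟨_, _, _, _, _, hd, rfl⟩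

/-- The matrices that have suitable coprime powers. -/
def HasPowers (α : Matrix (Fin 2) (Fin 2) A) : Prop :=
  α.det = 1 ∧ ∃ k l : ℕ, k = l + 1 ∧ InSpan α (α 0 1) (α ^ k) ∧
    InSpan α.transpose (α 1 0) (α.transpose ^ l)

theorem covered_hasPowers (h2 : IsUnit (2 : A)) {k : ℕ} (hk : Covered k (almostScalar A)) :
    Covered (k + k) {α : Matrix (Fin 2) (Fin 2) A | HasPowers α} := by
  refine Covered.mul hk ((covered_almostScalar_transpose hk).adjugate_fin_two
    (Z := {M | ∃ x, x.transpose ∈ almostScalar A ∧ M = x.adjugate})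
    fun _ ⟨x, hx, h⟩ => ⟨x, hx, h⟩) ?_
  rintro α ⟨hα, _, l, rfl, h3, h4⟩
  have hd : ∀ i, (α ^ i).det = 1 := fun i => by rw [Matrix.det_pow, hα, one_pow]
  refine ⟨_, h3.mem_almostScalar h2 (hd _), _, ⟨α ^ l, ?_, rfl⟩, ?_⟩
  · rw [Matrix.transpose_pow]
    refine InSpan.mem_almostScalar h2 h4 ?_
    rw [← Matrix.transpose_pow, Matrix.det_transpose, hd]
  · rw [pow_succ', Matrix.mul_assoc, Matrix.mul_adjugate, hd, one_smul, Matrix.mul_one]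

end Powers

section Arithmetic

theorem coprime_geom_sum {p e m j q : ℕ} (hpq : p ∣ q) (hq : 1 < q)
    (hpm : m.Coprime q) (hj : 1 < j) (hjm : j ≡ 1 [MOD (m * (q - 1)).totient]) :
    (p ^ e * m * p).Coprime (∑ i ∈ Finset.range j, q ^ i) := by
  obtain ⟨i, rfl⟩ : ∃ i, j = i + 1 := ⟨j - 1, by omega⟩
  have hi : (m * (q - 1)).totient ∣ i := by
    have := (Nat.modEq_iff_dvd' (by omega : 1 ≤ i + 1)).mp hjm.symm
    simpa using this
  have hsum : ∑ k ∈ Finset.range (i + 1), q ^ k = q * (∑ k ∈ Finset.range i, q ^ k) + 1 := by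
    rw [Finset.sum_range_succ', Finset.mul_sum]
    simp [pow_succ']
  have hcop : q.Coprime (m * (q - 1)) := by
    refine Nat.Coprime.mul_right hpm.symm ?_
    exact (Nat.coprime_self_sub_right hq.le).mpr (by simp)
  have hdvd : m * (q - 1) ∣ (∑ k ∈ Finset.range i, q ^ k) * (q - 1) := by
    have h1 : q ^ i ≡ 1 [MOD m * (q - 1)] := by
      obtain ⟨r, rfl⟩ := hi
      rw [pow_mul]
      simpa using (Nat.ModEq.pow_totient hcop).pow r
    have h2 := (Nat.modEq_iff_dvd' (Nat.one_le_pow _ _ (by omega))).mp h1.symm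
    have h3 := geom_sum_mul_add (q - 1) i
    rw [Nat.sub_add_cancel hq.le] at h3
    rwa [← h3, Nat.add_sub_cancel] at h2
  have hmS := Nat.dvd_of_mul_dvd_mul_right (by omega) hdvd
  rw [hsum]
  have hcp : p.Coprime (q * (∑ k ∈ Finset.range i, q ^ k) + 1) := by
    obtain ⟨r, rfl⟩ := hpq
    rw [mul_assoc]
    simp
  have hcm : m.Coprime (q * (∑ k ∈ Finset.range i, q ^ k) + 1) := by
    obtain ⟨r, hr⟩ := hmS
    rw [hr, mul_left_comm]
    simp
  exact ((hcp.pow_left e).mul_left hcm).mul_left hcp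

end Arithmetic

section SpecialLinearTwo

variable {F : Type} [Field F] [Fintype F]

theorem exists_pow_sub_one_dvd {a b : F[X]} (hb : b ≠ 0) (h : IsCoprime b a) :
    ∃ m, 0 < m ∧ b ∣ a ^ m - 1 := by
  have := finite_quotient hb
  obtain ⟨u, hu⟩ := isUnit_mk_iff.mpr h
  have : Finite (F[X] ⧸ Ideal.span {b})ˣ := inferInstance
  refine ⟨Nat.card (F[X] ⧸ Ideal.span {b})ˣ, Nat.card_pos, ?_⟩
  rw [← Ideal.mem_span_singleton, ← Ideal.Quotient.eq_zero_iff_mem, map_sub, map_pow, map_one,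
    ← hu, ← Units.val_pow_eq_pow_val, pow_card_eq_one', Units.val_one, sub_self]

theorem exists_hasPowers {a b c d : F[X]} (hdet : a * d - b * c = 1) (hb : b ≠ 0)
    (ha : a.natDegree ≡ 1 [MOD Fintype.card F - 1]) (ha0 : 0 < a.natDegree) :
    ∃ l : F[X], HasPowers !![a, b; c + l * a, d + l * b] := by
  obtain ⟨p, hp⟩ := CharP.exists F
  obtain ⟨r, hpp, hcard⟩ := FiniteField.card F p
  have hq1 : 1 < Fintype.card F := Fintype.one_lt_card
  have hpq : p ∣ Fintype.card F := hcard ▸ dvd_pow_self p r.ne_zero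
  obtain ⟨m₀, hm₀, hbm⟩ := exists_pow_sub_one_dvd hb (a := a)
    ⟨-c, d, by linear_combination hdet⟩
  obtain ⟨e, m, hpm, rfl⟩ := Nat.exists_eq_pow_mul_and_not_dvd hm₀.ne' p hpp.ne_one
  have hm : m ≠ 0 := fun h => hpm (h ▸ dvd_zero p)
  have hmq : m.Coprime (Fintype.card F) := by
    rw [hcard]
    exact (((Nat.Prime.coprime_iff_not_dvd hpp).mpr hpm).symm).pow_right _
  have htot : 0 < (m * (Fintype.card F - 1)).totient :=
    Nat.totient_pos.mpr (Nat.mul_pos (Nat.pos_of_ne_zero hm) (by omega))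
  obtain ⟨l, hirr, hj, hB, hdvd⟩ := exists_irreducible_norm_one
    (ne_zero_of_natDegree_gt ha0) ha (c₁ := c) ⟨d, -b, by linear_combination hdet⟩
    (N := (m * (Fintype.card F - 1)).totient * (Fintype.card F - 1))
    (Nat.mul_pos htot (by omega)) (dvd_mul_left _ _) (2 * a.natDegree)
  set n := ∑ i ∈ Finset.range (c + l * a).natDegree, Fintype.card F ^ i with hn
  have hcop : (p ^ e * m * p).Coprime n :=
    coprime_geom_sum hpq hq1 hmq (by omega) (hj.of_dvd (dvd_mul_right _ _))
  have hn1 : 1 < n := by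
    have : ∑ i ∈ Finset.range 2, Fintype.card F ^ i ≤ n :=
      Finset.sum_le_sum_of_subset (Finset.range_mono (by omega))
    simp [Finset.sum_range_succ] at this
    omega
  obtain ⟨u, -, hu⟩ := Nat.exists_mul_mod_eq_one_of_coprime hcop hn1
  have hdet' : (!![a, b; c + l * a, d + l * b]).det = 1 := by
    rw [Matrix.det_fin_two_of]
    linear_combination hdet
  refine ⟨l, hdet', p ^ e * m * p * u, n * (p ^ e * m * p * u / n), ?_, ?_, ?_⟩
  · rw [← hu, Nat.div_add_mod]
  · rw [pow_mul]
    refine (inSpan_pow_mul hdet' dvd_rfl hbm ?_).pow hdet' u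
    rw [← C_eq_natCast, CharP.cast_eq_zero, C_0]
  · rw [pow_mul]
    have hdet'' := hdet'
    rw [← Matrix.det_transpose] at hdet''
    refine (inSpan_pow_of_prime hdet'' dvd_rfl hirr.prime hdvd ?_).pow hdet'' _
    intro h
    change c + l * a ∣ a ^ 2 - 1 at h
    have hdeg : (a ^ 2 - 1).natDegree = 2 * a.natDegree := by
      rw [natDegree_sub_eq_left_of_natDegree_lt, natDegree_pow]
      rw [natDegree_pow, natDegree_one]
      omega
    have := natDegree_le_of_dvd h (ne_zero_of_natDegree_gt (n := 0) (by omega))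
    omega

theorem covered_det_eq_one_fin_two (hq : Odd (Fintype.card F)) :
    Covered 31 {M : Matrix (Fin 2) (Fin 2) F[X] | M.det = 1} := by
  have h28 : Covered 28 {α : Matrix (Fin 2) (Fin 2) F[X] | HasPowers α} :=
    covered_hasPowers (isUnit_two hq) (covered_almostScalar (covered_equalDiag hq))
  refine Covered.sandwich (σ := Fin 3) (L := fun v => lower (v 0))
    (R := fun v => lower (v 1) * upper (v 2)) (isPolyMat_lower (.var 0))
    ((isPolyMat_lower (.var 1)).mul (isPolyMat_upper (.var 2)))
    (fun v => det_lower _) (fun v => by rw [Matrix.det_mul, det_lower, det_upper, one_mul]) h28 ?_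
  intro M hM
  obtain ⟨a, b, c, d, rfl⟩ : ∃ a b c d, M = !![a, b; c, d] :=
    ⟨_, _, _, _, Matrix.eta_fin_two M⟩
  rw [Set.mem_ofPred_eq, Matrix.det_fin_two_of] at hM
  obtain ⟨s, hs⟩ : ∃ s : F[X], b + s * a ≠ 0 := by
    by_cases hb : b = 0
    · refine ⟨1, fun h => ?_⟩
      have : a = 0 := by simpa [hb] using h
      simp [hb, this] at hM
    · exact ⟨0, by simpa using hb⟩
  obtain ⟨k, hk, hk0⟩ := exists_natDegree_add_mul (Fintype.card F - 1)
    (Nat.sub_pos_of_lt Fintype.one_lt_card) a hs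
  obtain ⟨l, hl⟩ := exists_hasPowers (a := a + k * (b + s * a)) (b := b + s * a)
    (c := c + k * (d + s * c)) (d := d + s * c) (by linear_combination hM) hs hk hk0
  refine ⟨![-l, -k, -s], _, hl, ?_⟩
  change _ = lower (-l) * _ * (lower (-k) * upper (-s))
  simp only [lower, upper, Matrix.mul_fin_two]
  apply matrix_fin_two_congr <;> ring

end SpecialLinearTwo

section Unimodular

variable {A : Type} [CommRing A] [IsDomain A] [IsPrincipalIdealRing A]

theorem exists_isCoprime_add_mul {x y g : A} (hg : g ≠ 0)
    (h : ∀ p, Prime p → p ∣ x → p ∣ y → ¬ p ∣ g) : ∃ s, IsCoprime (y + s * x) g := by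
  induction g using UniqueFactorizationMonoid.induction_on_prime with
  | h₁ => exact absurd rfl hg
  | h₂ u hu =>
    obtain ⟨w, hw⟩ := hu
    exact ⟨0, 0, ↑w⁻¹, by simp [← hw]⟩
  | h₃ g p hg0 hp ih =>
    obtain ⟨s, hs⟩ := ih hg0 fun r hr hx hy hrg => h r hr hx hy (hrg.mul_left p)
    by_cases hpg : p ∣ y + s * x
    · have hpg' : ¬ p ∣ g := fun hd => hp.not_isUnit (hs.isUnit_of_dvd' hpg hd)
      have hpx : ¬ p ∣ x := fun hd => h p hp hd
        ((dvd_add_left (hd.mul_left s)).mp hpg) (dvd_mul_right p g)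
      refine ⟨s + g, IsCoprime.mul_right ?_ ?_⟩
      · refine ((Prime.coprime_iff_not_dvd hp).mpr fun hd => ?_).symm
        have : p ∣ g * x := by
          convert dvd_sub hd hpg using 1
          ring
        exact (hp.dvd_or_dvd this).elim hpg' hpx
      · convert IsCoprime.add_mul_left_left hs x using 1
        ring
    · exact ⟨s, IsCoprime.mul_right ((Prime.coprime_iff_not_dvd hp).mpr hpg).symm hs⟩

/-- Stable range: a unimodular column can be shortened by adding multiples of its first entry to
two of the others. -/
theorem exists_unimodular_add {m : Type} [Fintype m] [DecidableEq m] {i j : m} (hij : i ≠ j)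
    {x a : A} {v w : m → A} (h : a * x + ∑ l, w l * v l = 1) :
    ∃ s t : A, ∃ k : m → A,
      ∑ l, k l * (v l + (Pi.single i s + Pi.single j t : m → A) l * x) = 1 := by
  by_cases hx : x = 0
  · exact ⟨0, 0, w, by simpa [hx] using h⟩
  obtain ⟨t, ht⟩ : ∃ t, v j + t * x ≠ 0 := by
    by_cases hv : v j = 0
    · exact ⟨1, by simpa [hv] using hx⟩
    · exact ⟨0, by simpa using hv⟩
  set v₁ : m → A := fun l => if l = i then 0 else v l + (Pi.single j t : m → A) l * x with hv₁
  obtain ⟨g, hg⟩ := IsPrincipalIdealRing.principal (Ideal.span (Set.range v₁))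
  have hmem : ∀ l, g ∣ v₁ l := fun l => by
    rw [← Ideal.mem_span_singleton]
    exact hg.le (Ideal.subset_span ⟨l, rfl⟩)
  have hg0 : g ≠ 0 := by
    rintro rfl
    have := hmem j
    simp [hv₁, hij.symm, ht] at this
  obtain ⟨s, α, β, hs⟩ := exists_isCoprime_add_mul (x := x) (y := v i) hg0 (by
    intro p hp hpx hpi hpg
    have hall : ∀ l, p ∣ v l := fun l => by
      by_cases hl : l = i
      · exact hl ▸ hpi
      · have := hpg.trans (hmem l)
        simp only [hv₁, hl, if_false] at this
        exact (dvd_add_left (hpx.mul_left _)).mp this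
    refine hp.not_isUnit (isUnit_of_dvd_one (h ▸ dvd_add (hpx.mul_left a) ?_))
    exact Finset.dvd_sum fun l _ => (hall l).mul_left _)
  refine ⟨s, t, ?_⟩
  set v₂ : m → A := fun l => v l + (Pi.single i s + Pi.single j t : m → A) l * x with hv₂
  have hle : Ideal.span (Set.range v₁) ≤ Ideal.span (Set.range v₂) := by
    rw [Ideal.span_le]
    rintro _ ⟨l, rfl⟩
    by_cases hl : l = i
    · simp [hv₁, hl]
    · have : v₁ l = v₂ l := by simp [hv₁, hv₂, hl]
      rw [this]
      exact Ideal.subset_span ⟨l, rfl⟩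
  have hone : (1 : A) ∈ Ideal.span (Set.range v₂) := by
    rw [← hs]
    refine add_mem (Ideal.mul_mem_left _ _ (Ideal.subset_span ⟨i, ?_⟩))
      (Ideal.mul_mem_left _ _ (hle ?_))
    · simp [hv₂, hij]
    · rw [hg]
      exact Ideal.mem_span_singleton_self g
  obtain ⟨k, hk⟩ := Submodule.mem_span_range_iff_exists_fun A |>.mp hone
  exact ⟨k, hk⟩

end Unimodular

section Reduction

open Matrix

variable {A : Type} [CommRing A] {m : Type} [DecidableEq m]

/-- The block lower unipotent matrix with first column `(1, u)`. -/
def lowerBlock (u : m → A) : Matrix (Unit ⊕ m) (Unit ⊕ m) A :=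
  fromBlocks 1 0 (replicateCol Unit u) 1

/-- The block upper unipotent matrix with first row `(1, u)`. -/
def upperBlock (u : m → A) : Matrix (Unit ⊕ m) (Unit ⊕ m) A :=
  fromBlocks 1 (replicateRow Unit u) 0 1

theorem isPolyMat_fromBlocks {σ κ l : Type} {a : (σ → A) → Matrix κ κ A}
    {b : (σ → A) → Matrix κ l A} {c : (σ → A) → Matrix l κ A} {d : (σ → A) → Matrix l l A}
    (ha : IsPolyMat a) (hb : ∀ i j, IsPoly fun v => b v i j)
    (hc : ∀ i j, IsPoly fun v => c v i j) (hd : IsPolyMat d) :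
    IsPolyMat fun v => fromBlocks (a v) (b v) (c v) (d v) := by
  rintro (i | i) (j | j)
  · exact ha i j
  · exact hb i j
  · exact hc i j
  · exact hd i j

theorem isPolyMat_lowerBlock {σ : Type} {u : m → (σ → A) → A} (hu : ∀ i, IsPoly (u i)) :
    IsPolyMat fun v => lowerBlock fun i => u i v :=
  isPolyMat_fromBlocks (.const 1) (fun _ _ => .const 0) (fun i _ => hu i) (.const 1)

theorem isPolyMat_upperBlock {σ : Type} {u : m → (σ → A) → A} (hu : ∀ i, IsPoly (u i)) :
    IsPolyMat fun v => upperBlock fun i => u i v :=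
  isPolyMat_fromBlocks (.const 1) (fun _ j => hu j) (fun _ _ => .const 0) (.const 1)

variable [Fintype m]

theorem det_lowerBlock (u : m → A) : (lowerBlock u).det = 1 := by
  simp [lowerBlock]

theorem det_upperBlock (u : m → A) : (upperBlock u).det = 1 := by
  simp [upperBlock]

theorem lowerBlock_mul_apply_inl (u : m → A) (M : Matrix (Unit ⊕ m) (Unit ⊕ m) A) (a : Unit)
    (c : Unit ⊕ m) : (lowerBlock u * M) (.inl a) c = M (.inl a) c := by
  simp [lowerBlock, mul_apply, one_apply]

theorem lowerBlock_mul_apply_inr (u : m → A) (M : Matrix (Unit ⊕ m) (Unit ⊕ m) A) (l : m)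
    (c : Unit ⊕ m) :
    (lowerBlock u * M) (.inr l) c = M (.inr l) c + u l * M (.inl ()) c := by
  simp [lowerBlock, mul_apply, one_apply, add_comm]

theorem upperBlock_mul_apply_inl (u : m → A) (M : Matrix (Unit ⊕ m) (Unit ⊕ m) A)
    (c : Unit ⊕ m) :
    (upperBlock u * M) (.inl ()) c = M (.inl ()) c + ∑ l, u l * M (.inr l) c := by
  simp [upperBlock, mul_apply, one_apply]

theorem upperBlock_mul_apply_inr (u : m → A) (M : Matrix (Unit ⊕ m) (Unit ⊕ m) A) (l : m)
    (c : Unit ⊕ m) : (upperBlock u * M) (.inr l) c = M (.inr l) c := by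
  simp [upperBlock, mul_apply, one_apply]

theorem lowerBlock_neg_mul_cancel_left (u : m → A) (M : Matrix (Unit ⊕ m) (Unit ⊕ m) A) :
    lowerBlock (-u) * (lowerBlock u * M) = M := by
  ext (a | l) c
  · rw [lowerBlock_mul_apply_inl, lowerBlock_mul_apply_inl]
  · simp [lowerBlock_mul_apply_inr, lowerBlock_mul_apply_inl]

theorem upperBlock_neg_mul_cancel_left (u : m → A) (M : Matrix (Unit ⊕ m) (Unit ⊕ m) A) :
    upperBlock (-u) * (upperBlock u * M) = M := by
  ext (a | l) c
  · rw [upperBlock_mul_apply_inl, upperBlock_mul_apply_inl]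
    simp [upperBlock_mul_apply_inr]
  · rw [upperBlock_mul_apply_inr, upperBlock_mul_apply_inr]

theorem covered_fromBlocks {k : ℕ} {X : Set (Matrix m m A)} (hX : Covered k X) :
    Covered k {M : Matrix (Unit ⊕ m) (Unit ⊕ m) A | ∃ N ∈ X, M = fromBlocks 1 0 0 N} := by
  obtain ⟨σ, _, f, hc, hf, hd, hfX⟩ := hX
  refine ⟨σ, _, fun v => fromBlocks 1 0 0 (f v), hc,
    isPolyMat_fromBlocks (.const 1) (fun _ _ => .const 0) (fun _ _ => .const 0) hf,
    fun v => by simp [hd], ?_⟩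
  rintro _ ⟨N, hN, rfl⟩
  obtain ⟨v, rfl⟩ := hfX hN
  exact ⟨v, rfl⟩

theorem covered_reindex {κ : Type} [Fintype κ] [DecidableEq κ] (e : m ≃ κ) {k : ℕ}
    (h : Covered k {M : Matrix m m A | M.det = 1}) :
    Covered k {M : Matrix κ κ A | M.det = 1} := by
  obtain ⟨σ, _, f, hc, hf, hd, hfX⟩ := h
  refine ⟨σ, _, fun v => reindex e e (f v), hc, fun i j => hf _ _,
    fun v => by rw [det_reindex_self, hd], fun M hM => ?_⟩
  obtain ⟨v, hv⟩ := hfX (show (reindex e.symm e.symm M).det = 1 by rwa [det_reindex_self])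
  exact ⟨v, by ext; simp [hv]⟩

variable [IsDomain A] [IsPrincipalIdealRing A]

theorem exists_eq_lower_upper_lower {i j : m} (hij : i ≠ j)
    {M : Matrix (Unit ⊕ m) (Unit ⊕ m) A} (hM : M.det = 1) :
    ∃ s t : A, ∃ k w r : m → A, ∃ N : Matrix m m A, N.det = 1 ∧
      M = lowerBlock (Pi.single i s + Pi.single j t) * upperBlock k * lowerBlock w *
        fromBlocks 1 0 0 N * upperBlock r := by
  have hadj : (M.adjugate * M) (.inl ()) (.inl ()) = 1 := by
    rw [adjugate_mul, hM, one_smul, one_apply_eq]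
  simp only [mul_apply, Fintype.sum_sum_type, Finset.univ_unique, Finset.sum_singleton] at hadj
  obtain ⟨s, t, k, hk⟩ := exists_unimodular_add hij hadj
  set x := M (.inl ()) (.inl ()) with hx
  set u : m → A := Pi.single i s + Pi.single j t with hu
  set w : m → A := fun l => M (.inr l) (.inl ()) + u l * x with hw
  set k' : m → A := (1 - x) • k with hk'
  set M' := lowerBlock (-w) * (upperBlock k' * (lowerBlock u * M)) with hM'
  have hcol₁ : M' (.inl ()) (.inl ()) = 1 := by
    rw [hM', lowerBlock_mul_apply_inl, upperBlock_mul_apply_inl, lowerBlock_mul_apply_inl]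
    simp only [lowerBlock_mul_apply_inr, hk', Pi.smul_apply, smul_eq_mul, mul_assoc,
      ← Finset.mul_sum]
    rw [← hx, hk]
    ring
  have hcol₂ : ∀ l, M' (.inr l) (.inl ()) = 0 := by
    intro l
    have hone : (upperBlock k' * (lowerBlock u * M)) (.inl ()) (.inl ()) = 1 := by
      rw [← hcol₁, hM', lowerBlock_mul_apply_inl]
    rw [hM', lowerBlock_mul_apply_inr, hone, upperBlock_mul_apply_inr, lowerBlock_mul_apply_inr]
    simp [hw, ← hx]
  have hblock : M' =
      fromBlocks 1 0 0 M'.toBlocks₂₂ * upperBlock fun l => M' (.inl ()) (.inr l) := by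
    rw [upperBlock, fromBlocks_multiply]
    ext (a | l) (b | c)
    · simpa using hcol₁
    · simp
    · simpa using hcol₂ l
    · simp [toBlocks₂₂]
  have hMM' : M = lowerBlock (-u) * upperBlock (-k') * lowerBlock w * M' := by
    have h₁ := lowerBlock_neg_mul_cancel_left (-w) (upperBlock k' * (lowerBlock u * M))
    rw [neg_neg] at h₁
    rw [hM', mul_assoc, mul_assoc, h₁, upperBlock_neg_mul_cancel_left,
      lowerBlock_neg_mul_cancel_left]
  refine ⟨-s, -t, -k', w, fun l => M' (.inl ()) (.inr l), M'.toBlocks₂₂, ?_, ?_⟩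
  · have hdet : M'.det = 1 := by
      rw [hM', det_mul, det_mul, det_mul, det_lowerBlock, det_upperBlock, det_lowerBlock, hM]
      ring
    rw [hblock, det_mul, det_upperBlock, det_fromBlocks_zero₂₁, det_one, one_mul, mul_one] at hdet
    exact hdet
  · have hneg : (Pi.single i (-s) + Pi.single j (-t) : m → A) = -u := by
      rw [hu, Pi.single_neg, Pi.single_neg, neg_add]
    rw [hneg, mul_assoc _ (fromBlocks _ _ _ _), ← hblock]
    exact hMM'

theorem covered_sum {i j : m} (hij : i ≠ j) {k : ℕ}
    (h : Covered k {M : Matrix m m A | M.det = 1}) :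
    Covered (3 * Fintype.card m + 2 + k)
      {M : Matrix (Unit ⊕ m) (Unit ⊕ m) A | M.det = 1} := by
  have hcard : 3 * Fintype.card m + 2 = Fintype.card (Fin 2 ⊕ (m ⊕ (m ⊕ m))) := by
    simp only [Fintype.card_sum, Fintype.card_fin]
    ring
  have hu : ∀ l, IsPoly fun v : (Fin 2 ⊕ (m ⊕ (m ⊕ m))) → A =>
      (Pi.single i (v (.inl 0)) + Pi.single j (v (.inl 1)) : m → A) l := by
    intro l
    simp only [Pi.add_apply, Pi.single_apply]
    refine IsPoly.add ?_ ?_ <;> split_ifs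
    exacts [.var _, .const 0, .var _, .const 0]
  have hL : IsPolyMat fun v : (Fin 2 ⊕ (m ⊕ (m ⊕ m))) → A =>
      lowerBlock (fun l => (Pi.single i (v (.inl 0)) + Pi.single j (v (.inl 1)) : m → A) l) *
        upperBlock (fun l => v (.inr (.inl l))) *
        lowerBlock (fun l => v (.inr (.inr (.inl l)))) :=
    ((isPolyMat_lowerBlock hu).mul (isPolyMat_upperBlock fun l => .var (Sum.inr (Sum.inl l)))).mul
      (isPolyMat_lowerBlock fun l => .var (Sum.inr (Sum.inr (Sum.inl l))))
  have hR : IsPolyMat fun v : (Fin 2 ⊕ (m ⊕ (m ⊕ m))) → A =>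
      upperBlock (fun l => v (.inr (.inr (.inr l)))) :=
    isPolyMat_upperBlock fun l => .var (Sum.inr (Sum.inr (Sum.inr l)))
  refine (Covered.sandwich hL hR
    (fun v => by simp only [det_mul, det_lowerBlock, det_upperBlock, mul_one])
    (fun v => det_upperBlock _) (covered_fromBlocks h) ?_).mono
    (Nat.add_le_add_right hcard.ge k) subset_rfl
  intro M hM
  obtain ⟨s, t, k, w, r, N, hN, hMN⟩ := exists_eq_lower_upper_lower hij hM
  refine ⟨Sum.elim ![s, t] (Sum.elim k (Sum.elim w r)), fromBlocks 1 0 0 N, ⟨N, hN, rfl⟩, ?_⟩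
  exact hMN

end Reduction

theorem covered_det_eq_one {F : Type} [Field F] [Fintype F] (hq : Odd (Fintype.card F))
    (n : ℕ) (hn : 2 ≤ n) :
    Covered (45 + n * (3 * n + 1) / 2) {M : Matrix (Fin n) (Fin n) F[X] | M.det = 1} := by
  induction n, hn using Nat.le_induction with
  | base => exact (covered_det_eq_one_fin_two hq).mono (by norm_num) subset_rfl
  | succ n hn ih =>
    have hij : (⟨0, by omega⟩ : Fin n) ≠ ⟨1, by omega⟩ := by simp
    have e : Unit ⊕ Fin n ≃ Fin (n + 1) := Fintype.equivOfCardEq (by simp [add_comm])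
    refine (covered_reindex e (covered_sum hij ih)).mono (le_of_eq ?_) subset_rfl
    have harith : (n + 1) * (3 * (n + 1) + 1) = n * (3 * n + 1) + 2 * (3 * n + 2) := by ring
    rw [harith, Nat.add_mul_div_left _ _ two_pos, Fintype.card_fin]
    ring

end FqT

/-- **SLₙ(𝔽_q[T]) is a polynomial family with `45 + n(3n+1)/2` parameters, for every
`n ≥ 2`.**  Here `F` is a finite field whose cardinality is odd (i.e. a power of an odd
prime `p`) and `A = F[T]`. -/
theorem sln_polynomial_family
    (F : Type) [Field F] [Fintype F] (hq : Odd (Fintype.card F))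
    (n : ℕ) (hn : 2 ≤ n) :
    ∃ P : Fin n → Fin n → MvPolynomial (Fin (45 + n * (3 * n + 1) / 2)) (Polynomial F),
      {M : Matrix (Fin n) (Fin n) (Polynomial F) | M.det = 1} =
        Set.range (fun v : Fin (45 + n * (3 * n + 1) / 2) → Polynomial F =>
          Matrix.of fun i j => MvPolynomial.eval v (P i j)) := by
  exact (FqT.covered_det_eq_one hq n hn).exists_range_eq
end

section
/- Let G be a group and let S be a subgroup of G of finite index. Then G has bounded generation if and only if S has bounded generation. -/
/-- A group `G` has *bounded generation* if there exist finitely many (at least one)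
elements `g₁, …, g_h` of `G` such that every element of `G` is a product
`g₁^{k₁} · g₂^{k₂} ⋯ g_h^{k_h}` with `kᵢ ∈ ℤ`; equivalently, `G = Γ₁·Γ₂⋯Γ_h` for
cyclic subgroups `Γᵢ = ⟨gᵢ⟩`. -/
def HasBoundedGeneration (G : Type*) [Group G] : Prop :=
  ∃ h : ℕ, 1 ≤ h ∧ ∃ g : Fin h → G, ∀ x : G, ∃ k : Fin h → ℤ,
    x = ((List.finRange h).map (fun i => g i ^ k i)).prod

open scoped Pointwise in
/-- The product `⟨g₁⟩⟨g₂⟩⋯⟨g_h⟩` of the cyclic subgroups generated by the entries of a list. -/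
def zpowersProd {G : Type*} [Group G] (L : List G) : Set G :=
  (L.map fun g => (Subgroup.zpowers g : Set G)).prod

/-- A subset of a group is boundedly covered if it lies in a finite product of cyclic subgroups. -/
def IsBoundedlyCovered {G : Type*} [Group G] (A : Set G) : Prop :=
  ∃ L : List G, A ⊆ zpowersProd L

section

variable {G : Type*} [Group G]

open scoped Pointwise

theorem zpowersProd_nil : zpowersProd ([] : List G) = 1 := rfl

theorem zpowersProd_cons (g : G) (L : List G) :
    zpowersProd (g :: L) = (Subgroup.zpowers g : Set G) * zpowersProd L := by
  simp [zpowersProd]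

theorem zpowersProd_append (L M : List G) :
    zpowersProd (L ++ M) = zpowersProd L * zpowersProd M := by
  simp [zpowersProd]

theorem one_mem_zpowersProd (L : List G) : (1 : G) ∈ zpowersProd L := by
  induction L with
  | nil => simp [zpowersProd_nil]
  | cons g L ih =>
    rw [zpowersProd_cons]
    exact ⟨1, one_mem _, 1, ih, one_mul 1⟩

theorem mem_zpowersProd_ofFn {h : ℕ} {g : Fin h → G} {x : G} :
    x ∈ zpowersProd (List.ofFn g) ↔
      ∃ k : Fin h → ℤ, x = ((List.finRange h).map fun i => g i ^ k i).prod := by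
  rw [zpowersProd, List.map_ofFn, Set.mem_prod_list_ofFn]
  simp only [List.ofFn_eq_map]
  constructor
  · rintro ⟨f, rfl⟩
    choose k hk using fun i => Subgroup.mem_zpowers_iff.mp (f i).2
    exact ⟨k, by simp only [hk]⟩
  · rintro ⟨k, rfl⟩
    exact ⟨fun i => ⟨g i ^ k i, Subgroup.zpow_mem_zpowers (g i) (k i)⟩, rfl⟩

theorem map_mem_zpowersProd {H : Type*} [Group H] (f : G →* H) {L : List G} {x : G}
    (hx : x ∈ zpowersProd L) : f x ∈ zpowersProd (L.map f) := by
  induction L generalizing x with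
  | nil => simp_all [zpowersProd_nil]
  | cons g L ih =>
    rw [zpowersProd_cons] at hx
    obtain ⟨_, ⟨k, rfl⟩, y, hy, rfl⟩ := hx
    rw [List.map_cons, zpowersProd_cons]
    exact ⟨f g ^ k, ⟨k, rfl⟩, f y, ih hy, by simp⟩

namespace IsBoundedlyCovered

theorem mono {A B : Set G} (hB : IsBoundedlyCovered B) (hAB : A ⊆ B) : IsBoundedlyCovered A :=
  hB.imp fun _ hL => hAB.trans hL

theorem mul {A B : Set G} (hA : IsBoundedlyCovered A) (hB : IsBoundedlyCovered B) :
    IsBoundedlyCovered (A * B) := by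
  obtain ⟨L, hL⟩ := hA
  obtain ⟨M, hM⟩ := hB
  exact ⟨L ++ M, zpowersProd_append L M ▸ Set.mul_subset_mul hL hM⟩

theorem union {A B : Set G} (hA : IsBoundedlyCovered A) (hB : IsBoundedlyCovered B) :
    IsBoundedlyCovered (A ∪ B) := by
  obtain ⟨L, hL⟩ := hA
  obtain ⟨M, hM⟩ := hB
  refine ⟨L ++ M, zpowersProd_append L M ▸ Set.union_subset (fun x hx => ?_) fun x hx => ?_⟩
  · exact ⟨x, hL hx, 1, one_mem_zpowersProd M, mul_one x⟩
  · exact ⟨1, one_mem_zpowersProd L, x, hM hx, one_mul x⟩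

theorem zpowers (g : G) : IsBoundedlyCovered (Subgroup.zpowers g : Set G) :=
  ⟨[g], by simp [zpowersProd]⟩

theorem biUnion {ι : Type*} {s : Set ι} (hs : s.Finite) {A : ι → Set G}
    (hA : ∀ i, IsBoundedlyCovered (A i)) : IsBoundedlyCovered (⋃ i ∈ s, A i) := by
  induction s, hs using Set.Finite.induction_on with
  | empty => exact ⟨[], by simp⟩
  | insert _ _ ih =>
    rw [Set.biUnion_insert]
    exact (hA _).union ih

theorem of_finite {A : Set G} (hA : A.Finite) : IsBoundedlyCovered A :=
  (biUnion hA zpowers).mono fun x hx => Set.mem_biUnion hx (Subgroup.mem_zpowers x)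

theorem image {H : Type*} [Group H] (f : G →* H) {A : Set G} (hA : IsBoundedlyCovered A) :
    IsBoundedlyCovered (f '' A) := by
  obtain ⟨L, hL⟩ := hA
  exact ⟨L.map f, Set.image_subset_iff.mpr fun _ hx => map_mem_zpowersProd f (hL hx)⟩

end IsBoundedlyCovered

theorem hasBoundedGeneration_iff_isBoundedlyCovered_univ :
    HasBoundedGeneration G ↔ IsBoundedlyCovered (Set.univ : Set G) := by
  constructor
  · rintro ⟨h, -, g, hg⟩
    exact ⟨List.ofFn g, fun x _ => mem_zpowersProd_ofFn.mpr (hg x)⟩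
  · rintro ⟨L, hL⟩
    refine ⟨(1 :: L).length, by simp, (1 :: L).get, fun x => mem_zpowersProd_ofFn.mp ?_⟩
    rw [List.ofFn_get, zpowersProd_cons]
    exact ⟨1, one_mem _, x, hL trivial, one_mul x⟩

/-- The part of a translate of a finite product of cyclic subgroups that lies in a finite-index
subgroup `S` is covered by a finite product of cyclic subgroups of `S`. -/
theorem isBoundedlyCovered_preimage_smul_zpowersProd {S : Subgroup G} (hS : S.index ≠ 0)
    (L : List G) (t : G) :
    IsBoundedlyCovered ((↑) ⁻¹' (t • zpowersProd L) : Set S) := by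
  induction L generalizing t with
  | nil =>
    refine .of_finite (Set.Finite.preimage Subtype.val_injective.injOn ?_)
    simp [zpowersProd_nil]
  | cons g L ih =>
    obtain ⟨n, hn, -, hmem⟩ :=
      Subgroup.exists_pow_mem_of_index_ne_zero hS (t * g * t⁻¹)
    have hn' : (n : ℤ) ≠ 0 := by exact_mod_cast hn.ne'
    refine ((IsBoundedlyCovered.zpowers (⟨_, hmem⟩ : S)).mul
      (.biUnion (Set.finite_Ico (0 : ℤ) n) fun r => ih (t * g ^ r))).mono ?_
    rintro ⟨_, hx⟩ ⟨_, hy, rfl⟩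
    rw [zpowersProd_cons] at hy
    obtain ⟨_, ⟨k, rfl⟩, p, hp, rfl⟩ := hy
    set c : S := ⟨_, hmem⟩ ^ (k / n) with hc
    have hcG : (c : G) = t * g ^ (n * (k / n)) * t⁻¹ := by
      rw [hc, Subgroup.coe_zpow, Subgroup.coe_mk, ← zpow_natCast, ← zpow_mul, conj_zpow]
    refine ⟨c, ⟨k / n, rfl⟩, c⁻¹ * ⟨_, hx⟩, Set.mem_biUnion (x := k % n)
      ⟨Int.emod_nonneg k hn', Int.emod_lt_of_pos k (by exact_mod_cast hn)⟩
      ⟨p, hp, ?_⟩, mul_inv_cancel_left _ _⟩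
    have hg : g ^ k = g ^ (n * (k / n)) * g ^ (k % n) := by
      rw [← zpow_add, Int.mul_ediv_add_emod]
    simp [hcG, hg, mul_assoc]

end

/-- **Bounded generation passes to and from finite-index subgroups.**
If `S` is a subgroup of finite index in a group `G`, then `G` has bounded generation
if and only if `S` has bounded generation. -/
theorem hasBoundedGeneration_iff_of_finiteIndex
    (G : Type*) [Group G] (S : Subgroup G) (hS : S.index ≠ 0) :
    HasBoundedGeneration G ↔ HasBoundedGeneration S := by
  simp only [hasBoundedGeneration_iff_isBoundedlyCovered_univ]
  constructor
  · rintro ⟨L, hL⟩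
    refine (isBoundedlyCovered_preimage_smul_zpowersProd hS L 1).mono fun x _ => ?_
    exact ⟨x, hL trivial, one_smul G (x : G)⟩
  · intro h
    have : S.FiniteIndex := ⟨hS⟩
    have hT : IsBoundedlyCovered (Set.range (Quotient.out : G ⧸ S → G)) :=
      .of_finite (Set.finite_range (ι := G ⧸ S) _)
    refine (hT.mul (h.image S.subtype)).mono fun x _ => ?_
    obtain ⟨s, hs⟩ := QuotientGroup.mk_out_eq_mul S x
    exact ⟨_, ⟨(x : G ⧸ S), rfl⟩, _, ⟨s⁻¹, trivial, rfl⟩, by simp [hs]⟩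
end

section
/- Let q be a power of an odd prime and let A = 𝔽_q[T]. For every nonzero ε ∈ 𝔽_q and every integer r ≥ 1: (i) diag(ε, ε⁻¹) · G_r(A^r) ⊆ G_{r+4}(A^{r+4}), and (ii) diag(ε, ε⁻¹) · F_r(A^r) ⊆ F_{r+4}(A^{r+4}), where diag(ε, ε⁻¹) = [[ε, 0], [0, ε⁻¹]]. -/
open Polynomial Matrix

/-- The elementary matrix `m_{12} = [[1, m], [0, 1]]`. -/
def m₁₂ {R : Type*} [CommRing R] (m : R) : Matrix (Fin 2) (Fin 2) R := !![1, m; 0, 1]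

/-- The elementary matrix `m_{21} = [[1, 0], [m, 1]]`. -/
def m₂₁ {R : Type*} [CommRing R] (m : R) : Matrix (Fin 2) (Fin 2) R := !![1, 0; m, 1]

/-- The matrix `J = [[0, 1], [−1, 0]]`. -/
def Jmat (R : Type*) [CommRing R] : Matrix (Fin 2) (Fin 2) R := !![0, 1; -1, 0]

/-- `F_r(m₁, …, m_r)`: the alternating product whose `k`-th factor (k = 1, …, r) is
`(m_k)_{12}` for odd `k` and `(m_k)_{21}` for even `k`. -/
def Fmat {R : Type*} [CommRing R] (r : ℕ) (m : Fin r → R) : Matrix (Fin 2) (Fin 2) R :=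
  ((List.finRange r).map (fun k => if k.val % 2 = 0 then m₁₂ (m k) else m₂₁ (m k))).prod

/-- `G_r(m₁, …, m_r) = J · F_r(m₁, …, m_r) · J⁻¹`. -/
noncomputable def Gmat {R : Type*} [CommRing R] (r : ℕ) (m : Fin r → R) :
    Matrix (Fin 2) (Fin 2) R :=
  Jmat R * Fmat r m * (Jmat R)⁻¹

/-- `F_r(A^r)`: the set of values of `F_r` as `m₁, …, m_r` range over `R`. -/
def FSet (R : Type*) [CommRing R] (r : ℕ) : Set (Matrix (Fin 2) (Fin 2) R) :=
  Set.range (fun m : Fin r → R => Fmat r m)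

/-- `G_r(A^r)`: the set of values of `G_r` as `m₁, …, m_r` range over `R`. -/
def GSet (R : Type*) [CommRing R] (r : ℕ) : Set (Matrix (Fin 2) (Fin 2) R) :=
  Set.range (fun m : Fin r → R => Gmat r m)

theorem Fmat_cons_cons {R : Type*} [CommRing R] (a b : R) (r : ℕ) (m : Fin r → R) :
    Fmat (r + 2) (Fin.cons a (Fin.cons b m : Fin (r + 1) → R)) = m₁₂ a * m₂₁ b * Fmat r m := by
  simp [Fmat, List.finRange_succ, Function.comp_def, mul_assoc, add_assoc]

/-- A diagonal matrix of determinant one is a product of four elementary matrices. -/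
theorem diag_eq_elementary_prod {R : Type*} [CommRing R] {u v : R} (h : u * v = 1) :
    (!![u, 0; 0, v] : Matrix (Fin 2) (Fin 2) R) =
      m₁₂ (-u) * m₂₁ (v - 1) * (m₁₂ 1 * m₂₁ (u - 1)) := by
  ext i j
  fin_cases i <;> fin_cases j <;> simp [m₁₂, m₂₁, Matrix.mul_apply, Fin.sum_univ_two] <;> grind

theorem diag_mul_mem_FSet {R : Type*} [CommRing R] {u v : R} (h : u * v = 1) {r : ℕ}
    {x : Matrix (Fin 2) (Fin 2) R} (hx : x ∈ FSet R r) :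
    !![u, 0; 0, v] * x ∈ FSet R (r + 4) := by
  obtain ⟨m, rfl⟩ := hx
  refine ⟨Fin.cons (-u) (Fin.cons (v - 1) (Fin.cons 1 (Fin.cons (u - 1) m :
    Fin (r + 1) → R) : Fin (r + 2) → R) : Fin (r + 3) → R), ?_⟩
  simp only [diag_eq_elementary_prod h, mul_assoc]
  rw [Fmat_cons_cons, Fmat_cons_cons]
  simp only [mul_assoc]

theorem diag_mul_Jmat {R : Type*} [CommRing R] (u v : R) :
    !![u, 0; 0, v] * Jmat R = Jmat R * !![v, 0; 0, u] := by
  simp [Jmat]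

theorem diag_mul_mem_GSet {R : Type*} [CommRing R] {u v : R} (h : u * v = 1) {r : ℕ}
    {x : Matrix (Fin 2) (Fin 2) R} (hx : x ∈ GSet R r) :
    !![u, 0; 0, v] * x ∈ GSet R (r + 4) := by
  obtain ⟨m, rfl⟩ := hx
  obtain ⟨n, hn⟩ := diag_mul_mem_FSet (mul_comm u v ▸ h) (Set.mem_range_self m)
  refine ⟨n, ?_⟩
  simp only at hn
  simp only [Gmat, hn, ← mul_assoc, diag_mul_Jmat]

/-- With `A = 𝔽_q[T]` (`q` a power of an odd prime), for every nonzero `ε ∈ 𝔽_q` and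
every `r ≥ 1`: (i) `diag(ε, ε⁻¹) · G_r(A^r) ⊆ G_{r+4}(A^{r+4})`, and
(ii) `diag(ε, ε⁻¹) · F_r(A^r) ⊆ F_{r+4}(A^{r+4})`. -/
theorem diag_eps_mul_FSet_GSet_subset
    (F : Type) [Field F] [Fintype F] (hq : Odd (Fintype.card F))
    (ε : F) (hε : ε ≠ 0) (r : ℕ) (hr : 1 ≤ r) :
    (∀ x ∈ GSet (Polynomial F) r,
      (!![C ε, 0; 0, C ε⁻¹] : Matrix (Fin 2) (Fin 2) (Polynomial F)) * x ∈
        GSet (Polynomial F) (r + 4)) ∧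
    (∀ x ∈ FSet (Polynomial F) r,
      (!![C ε, 0; 0, C ε⁻¹] : Matrix (Fin 2) (Fin 2) (Polynomial F)) * x ∈
        FSet (Polynomial F) (r + 4)) := by
  have h : C ε * C ε⁻¹ = 1 := by rw [← C_mul, mul_inv_cancel₀ hε, C_1]
  exact ⟨fun _ => diag_mul_mem_GSet h, fun _ => diag_mul_mem_FSet h⟩
end

section
/- Let R be a principal ideal domain and let M be a 2×2 matrix over R with determinant 1 and trace 2 (i.e., M is unipotent in SL₂(R)). Then there exist m₁, m₂, m₃ ∈ R such that M = [[1 + m₁m₂m₃, m₁²m₃], [−m₂²m₃, 1 − m₁m₂m₃]]. -/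
open Matrix

/-- In a principal ideal domain, a factorization `x ^ 2 = b * c` with `b ≠ 0` comes from a common
factor `k` and a pair `p, q` with `b = p ^ 2 * k`, `x = p * q * k` and `c = q ^ 2 * k`. -/
lemma exists_of_sq_eq_mul {R : Type*} [CommRing R] [IsDomain R] [IsPrincipalIdealRing R]
    {x b c : R} (hb : b ≠ 0) (h : x ^ 2 = b * c) :
    ∃ p q k : R, b = p ^ 2 * k ∧ x = p * q * k ∧ c = q ^ 2 * k := by
  obtain ⟨q, p, g, hqp, rfl, rfl⟩ := UniqueFactorizationMonoid.exists_reduced_factors' x b hb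
  have hg : g ≠ 0 := left_ne_zero_of_mul hb
  have hp : p ≠ 0 := right_ne_zero_of_mul hb
  have hgq : q ^ 2 * g = p * c := mul_left_cancel₀ hg (by linear_combination h)
  obtain ⟨k, rfl⟩ : p ∣ g :=
    (hqp.symm.pow_right (n := 2)).dvd_of_dvd_mul_left ⟨c, hgq⟩
  exact ⟨p, q, k, by ring, by ring, mul_left_cancel₀ hp (by linear_combination -hgq)⟩

/-- Every unipotent matrix in `SL₂(R)` over a principal ideal domain `R` (i.e. every
`2×2` matrix with determinant `1` and trace `2`) has the form
`[[1 + m₁m₂m₃, m₁²m₃], [−m₂²m₃, 1 − m₁m₂m₃]]` for some `m₁, m₂, m₃ ∈ R`. -/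
theorem unipotent_sl2_param
    (R : Type*) [CommRing R] [IsDomain R] [IsPrincipalIdealRing R]
    (M : Matrix (Fin 2) (Fin 2) R) (hdet : M.det = 1) (htr : M.trace = 2) :
    ∃ m₁ m₂ m₃ : R,
      M = !![1 + m₁ * m₂ * m₃, m₁ ^ 2 * m₃; -(m₂ ^ 2 * m₃), 1 - m₁ * m₂ * m₃] := by
  rw [det_fin_two] at hdet
  rw [trace_fin_two] at htr
  have h : (M 0 0 - 1) ^ 2 = M 0 1 * -M 1 0 := by
    linear_combination M 0 0 * htr - hdet
  suffices ∃ p q k : R, M 0 1 = p ^ 2 * k ∧ M 0 0 - 1 = p * q * k ∧ -M 1 0 = q ^ 2 * k by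
    obtain ⟨p, q, k, h01, h00, h10⟩ := this
    refine ⟨p, q, k, ?_⟩
    rw [eta_fin_two M, h01, ← h10, ← h00, neg_neg, add_sub_cancel,
      show M 1 1 = 1 - (M 0 0 - 1) by linear_combination htr]
  by_cases hb : M 0 1 = 0
  · have hx : M 0 0 - 1 = 0 := by simpa [hb] using h
    exact ⟨0, 1, -M 1 0, by simp [hb], by simp [hx], by simp⟩
  · exact exists_of_sq_eq_mul hb h
end

section
/- Let q be a power of an odd prime and let A = 𝔽_q[T]. Then the set M_Λ is closed under taking inverses: if α ∈ M_Λ then α⁻¹ ∈ M_Λ; and likewise if α ∈ M_Λᵀ then α⁻¹ ∈ M_Λᵀ. -/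
open Polynomial Matrix

/-- The set `M_Λ` of products `[[1+ae, be²], [c, 1+de]] · [[1+ae, ce²], [b, 1+de]]`
with `a, b, c, d, e ∈ R` such that the first factor has determinant `1`. -/
def MLambda (R : Type*) [CommRing R] : Set (Matrix (Fin 2) (Fin 2) R) :=
  {x | ∃ a b c d e : R,
    (!![1 + a * e, b * e ^ 2; c, 1 + d * e] : Matrix (Fin 2) (Fin 2) R).det = 1 ∧
    x = !![1 + a * e, b * e ^ 2; c, 1 + d * e] * !![1 + a * e, c * e ^ 2; b, 1 + d * e]}

/-- `M_Λᵀ`: the set of transposes of elements of `M_Λ`. -/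
def MLambdaT (R : Type*) [CommRing R] : Set (Matrix (Fin 2) (Fin 2) R) :=
  {x | ∃ y ∈ MLambda R, x = yᵀ}

/-- The inverse of the element of `M_Λ` with parameters `(a, b, c, d, e)` is the element with
parameters `(d, -c, -b, a, e)`. -/
theorem inv_mem_MLambda {R : Type*} [CommRing R] {α : Matrix (Fin 2) (Fin 2) R}
    (hα : α ∈ MLambda R) : α⁻¹ ∈ MLambda R := by
  obtain ⟨a, b, c, d, e, hdet, rfl⟩ := hα
  rw [det_fin_two_of] at hdet
  refine ⟨d, -c, -b, a, e, ?_, ?_⟩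
  · rw [det_fin_two_of]
    linear_combination hdet
  · have h₁ : (!![1 + a * e, b * e ^ 2; c, 1 + d * e]).det = 1 := by
      rw [det_fin_two_of, hdet]
    have h₂ : (!![1 + a * e, c * e ^ 2; b, 1 + d * e]).det = 1 := by
      rw [det_fin_two_of]
      linear_combination hdet
    rw [inv_def, det_mul, h₁, h₂, mul_one, Ring.inverse_one, one_smul, mul_fin_two, mul_fin_two,
      adjugate_fin_two_of]
    ext i j
    fin_cases i <;> fin_cases j <;> simp <;> ring

/-- With `A = 𝔽_q[T]` (`q` a power of an odd prime), `M_Λ` and `M_Λᵀ` are closed under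
taking (matrix) inverses. -/
theorem MLambda_inv_closed
    (F : Type) [Field F] [Fintype F] (hq : Odd (Fintype.card F)) :
    (∀ α ∈ MLambda (Polynomial F), α⁻¹ ∈ MLambda (Polynomial F)) ∧
    (∀ α ∈ MLambdaT (Polynomial F), α⁻¹ ∈ MLambdaT (Polynomial F)) := by
  refine ⟨fun _ hα => inv_mem_MLambda hα, ?_⟩
  rintro _ ⟨y, hy, rfl⟩
  exact ⟨y⁻¹, inv_mem_MLambda hy, (transpose_nonsing_inv y).symm⟩
end

section
/- Let q be a power of an odd prime and let A = 𝔽_q[T]. Let a, b, u ∈ A and let α ∈ SL₂(A) be a matrix whose first row is (1 + au, bu). Then there exist m, n ∈ A, a nonzero ε ∈ 𝔽_q, and β ∈ M_Λ such that, setting ℘ = b + m(1 + au), the matrix α · (um)_{12} · n_{21} · (−℘u)_{12} · β · (−ε⁻¹un)_{12} · (−εm)_{21} has second row equal to (εb, 1 + au). -/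
open Polynomial Matrix

/-- A binary diagonal quadratic form with nonzero coefficients over a finite field of odd
characteristic represents every element. -/
theorem FiniteField.exists_sq_sub_mul_sq_eq {K : Type*} [Field K] [Finite K] (h2 : (2 : K) ≠ 0)
    {a : K} (ha : a ≠ 0) (b : K) : ∃ x y : K, x ^ 2 - a * y ^ 2 = b := by
  have := Fintype.ofFinite K
  have hchar : ringChar K ≠ 2 := fun h => h2 <| by
    have := ringChar.Nat.cast_ringChar (R := K)
    rw [h] at this
    exact_mod_cast this
  obtain ⟨x, y, hxy⟩ := FiniteField.exists_root_sum_quadratic (R := K)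
    (f := X ^ 2 - C b) (g := C (-a) * X ^ 2) (degree_X_pow_sub_C (by decide) _)
    (degree_C_mul_X_pow 2 (neg_ne_zero.2 ha)) (FiniteField.odd_card_of_char_ne_two hchar)
  refine ⟨x, y, ?_⟩
  simp only [eval_sub, eval_pow, eval_X, eval_C, eval_mul] at hxy
  linear_combination hxy

namespace Polynomial

variable {F : Type*} [Field F]

/-- The form `x² - a y²` represents every residue class modulo a prime not dividing `2a`. -/
theorem exists_prime_dvd_sq_sub_mul_sq_sub [Finite F] (h2 : (2 : F) ≠ 0) {a p : F[X]}
    (hp : Prime p) (ha : ¬ p ∣ a) (b : F[X]) : ∃ x y : F[X], p ∣ x ^ 2 - a * y ^ 2 - b := by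
  have : Fact (Irreducible p) := ⟨hp.irreducible⟩
  have : Module.Finite F (AdjoinRoot p) := (AdjoinRoot.powerBasis hp.ne_zero).finite
  have : Finite (AdjoinRoot p) := Module.finite_of_finite F
  have h2' : (2 : AdjoinRoot p) ≠ 0 := by
    rw [← map_ofNat (AdjoinRoot.of p) 2]
    exact (map_ne_zero_iff _ (AdjoinRoot.of p).injective).2 h2
  obtain ⟨x, y, hxy⟩ := FiniteField.exists_sq_sub_mul_sq_eq h2'
    (mt AdjoinRoot.mk_eq_zero.1 ha) (AdjoinRoot.mk p b)
  obtain ⟨x, rfl⟩ := AdjoinRoot.mk_surjective x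
  obtain ⟨y, rfl⟩ := AdjoinRoot.mk_surjective y
  refine ⟨x, y, AdjoinRoot.mk_eq_zero.1 ?_⟩
  simpa [sub_eq_zero] using hxy

/-- Hensel lifting of representations by `x² - a y²` to powers of a prime. -/
theorem exists_prime_pow_dvd_sq_sub_mul_sq_sub [Finite F] (h2 : (2 : F) ≠ 0) {a b p : F[X]}
    (hp : Prime p) (ha : ¬ p ∣ a) (hb : ¬ p ∣ b) (i : ℕ) :
    ∃ x y : F[X], p ^ (i + 1) ∣ x ^ 2 - a * y ^ 2 - b := by
  induction i with
  | zero => simpa using exists_prime_dvd_sq_sub_mul_sq_sub h2 hp ha b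
  | succ i ih =>
    obtain ⟨x, y, c, hc⟩ := ih
    have hu : IsUnit (2 : F[X]) := (isUnit_iff_ne_zero.2 h2).map C
    have hp2 : ¬ p ∣ 2 := fun h => hp.not_isUnit (isUnit_of_dvd_unit h hu)
    by_cases hx : p ∣ x
    · have hy : ¬ p ∣ y := by
        intro hy
        apply hb
        have : b = x * x - a * y * y - p * (p ^ i * c) := by linear_combination -hc
        rw [this]
        exact ((hx.mul_left _).sub (hy.mul_left _)).sub (dvd_mul_right _ _)
      obtain ⟨r, s, hrs⟩ := hp.coprime_iff_not_dvd.2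
        (fun h => (hp.dvd_or_dvd h).elim (fun h => (hp.dvd_or_dvd h).elim hp2 ha) hy :
          ¬ p ∣ 2 * a * y)
      refine ⟨x, y + p ^ (i + 1) * (s * c), c * r - a * p ^ i * s ^ 2 * c ^ 2, ?_⟩
      linear_combination hc - p ^ (i + 1) * c * hrs
    · obtain ⟨r, s, hrs⟩ := hp.coprime_iff_not_dvd.2
        (fun h => (hp.dvd_or_dvd h).elim hp2 hx : ¬ p ∣ 2 * x)
      refine ⟨x - p ^ (i + 1) * (s * c), y, c * r + p ^ i * s ^ 2 * c ^ 2, ?_⟩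
      linear_combination hc - p ^ (i + 1) * c * hrs

/-- Over a finite field of odd characteristic, `x² - a y²` represents `b` modulo any nonzero
polynomial coprime to `a` and `b`. -/
theorem exists_dvd_sq_sub_mul_sq_sub [Finite F] (h2 : (2 : F) ≠ 0) {a b v : F[X]} (hv : v ≠ 0)
    (ha : IsCoprime v a) (hb : IsCoprime v b) : ∃ x y : F[X], v ∣ x ^ 2 - a * y ^ 2 - b := by
  induction v using UniqueFactorizationMonoid.induction_on_coprime with
  | h0 => exact absurd rfl hv
  | h1 hu => exact ⟨0, 0, hu.dvd⟩
  | hpr i hp =>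
    cases i with
    | zero => exact ⟨0, 0, by simp⟩
    | succ i =>
      rw [IsCoprime.pow_left_iff i.succ_pos] at ha hb
      exact exists_prime_pow_dvd_sq_sub_mul_sq_sub h2 hp (hp.coprime_iff_not_dvd.1 ha)
        (hp.coprime_iff_not_dvd.1 hb) i
  | @hcp v w hvw ihv ihw =>
    obtain ⟨x₁, y₁, c₁, h₁⟩ := ihv (left_ne_zero_of_mul hv) ha.of_mul_left_left hb.of_mul_left_left
    obtain ⟨x₂, y₂, c₂, h₂⟩ :=
      ihw (right_ne_zero_of_mul hv) ha.of_mul_left_right hb.of_mul_left_right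
    have hvw' : IsCoprime v w := hvw.isCoprime
    obtain ⟨r, s, hrs⟩ := id hvw'
    refine ⟨x₁ + (x₂ - x₁) * (r * v), y₁ + (y₂ - y₁) * (r * v), hvw'.mul_dvd ?_ ?_⟩
    · refine ⟨c₁ + r * (2 * x₁ * (x₂ - x₁) + (x₂ - x₁) ^ 2 * (r * v)
        - a * (2 * y₁ * (y₂ - y₁) + (y₂ - y₁) ^ 2 * (r * v))), ?_⟩
      linear_combination h₁
    · rw [eq_sub_of_add_eq hrs]
      refine ⟨c₂ + s * (-2 * x₂ * (x₂ - x₁) + (x₂ - x₁) ^ 2 * (s * w)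
        + a * (2 * y₂ * (y₂ - y₁) - (y₂ - y₁) ^ 2 * (s * w))), ?_⟩
      linear_combination h₂

end Polynomial

/-- If `x`, `v`, `y` generate the unit ideal and `y ≠ 0`, some `x + t v` is coprime to `y`. -/
theorem exists_isCoprime_add_mul {R : Type*} [CommRing R] [IsDomain R] [IsPrincipalIdealRing R]
    {x v y : R} (hy : y ≠ 0) (h : ∀ p, Prime p → p ∣ x → p ∣ v → ¬ p ∣ y) :
    ∃ t, IsCoprime (x + t * v) y := by
  induction y using UniqueFactorizationMonoid.induction_on_prime with
  | h₁ => exact absurd rfl hy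
  | h₂ y hu => exact ⟨0, isCoprime_one_right.of_isCoprime_of_dvd_right hu.dvd⟩
  | h₃ y p hy0 hp ih =>
    obtain ⟨t, ht⟩ := ih hy0 fun q hq hx hv hqy => h q hq hx hv (hqy.mul_left p)
    by_cases hpt : p ∣ x + t * v
    · have hpv : ¬ p ∣ v := fun hv =>
        h p hp ((dvd_add_left (hv.mul_left t)).1 hpt) hv (dvd_mul_right p y)
      have hpy : ¬ p ∣ y := fun hpy => hp.not_isUnit (ht.isUnit_of_dvd' hpt hpy)
      refine ⟨t + y, IsCoprime.mul_right ?_ ?_⟩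
      · refine (hp.coprime_iff_not_dvd.2 fun hd => ?_).symm
        have : p ∣ y * v := by
          convert dvd_sub hd hpt using 1
          ring
        exact (hp.dvd_or_dvd this).elim hpy hpv
      · have := ht.add_mul_left_left v
        convert this using 1
        ring
    · exact ⟨t, IsCoprime.mul_right (hp.coprime_iff_not_dvd.2 hpt).symm ht⟩

/-- Over a finite field of odd characteristic, a residue class `b` modulo `v` contains an element
modulo which `a` is a square, provided `v ≠ 0` is coprime to `a` and `b`. -/
theorem Polynomial.exists_add_mul_eq_sq {F : Type*} [Field F] [Finite F] (h2 : (2 : F) ≠ 0)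
    {a b v : F[X]} (hv : v ≠ 0) (ha : IsCoprime v a) (hb : IsCoprime v b) :
    ∃ m n s : F[X], a + n * (b + m * v) = s ^ 2 := by
  obtain ⟨x, y, hxy⟩ : ∃ x y : F[X], IsCoprime x y ∧ v ∣ x ^ 2 - a * y ^ 2 - b := by
    obtain ⟨x, y, hxy⟩ := exists_dvd_sq_sub_mul_sq_sub h2 hv ha hb
    obtain ⟨y, hy, hxy⟩ : ∃ y, y ≠ 0 ∧ v ∣ x ^ 2 - a * y ^ 2 - b := by
      by_cases hy : y = 0
      · refine ⟨v, hv, ?_⟩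
        subst hy
        have := hxy.sub (Dvd.intro_left (a * v) rfl : v ∣ a * v * v)
        convert this using 1
        ring
      · exact ⟨y, hy, hxy⟩
    obtain ⟨t, ht⟩ := exists_isCoprime_add_mul (x := x) (v := v) hy fun p hp hpx hpv hpy => by
      refine hp.not_isUnit (hb.isUnit_of_dvd' hpv ?_)
      have := ((hpx.mul_left x).sub (hpy.mul_left (a * y))).sub (hpv.trans hxy)
      convert this using 1
      ring
    refine ⟨x + t * v, y, ht, ?_⟩
    have := hxy.add (Dvd.intro_left (2 * x * t + t ^ 2 * v) rfl : v ∣ _ * v)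
    convert this using 1
    ring
  obtain ⟨hc, m, hm⟩ := hxy
  have hyN : IsCoprime y (b + m * v) := by
    have := (hc.symm.pow_right (n := 2)).add_mul_left_right (-(a * y))
    rwa [show x ^ 2 + y * -(a * y) = b + m * v by linear_combination hm] at this
  obtain ⟨r, k, hrk⟩ := hyN
  refine ⟨m, r ^ 2 - 2 * a * k + a * (b + m * v) * k ^ 2, x * r, ?_⟩
  linear_combination (-(r ^ 2)) * hm - a * (r * y - k * (b + m * v) + 1) * hrk

/-- If `a + n℘` is a square with `℘ = b + m(1 + au)`, then the transformation of the first row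
`(1 + au, bu)` into the second row `(b, 1 + au)` is possible with `ε = 1`. -/
theorem exists_mem_MLambda_of_add_mul_eq_sq {R : Type*} [CommRing R] {a b u m n s : R}
    {α : Matrix (Fin 2) (Fin 2) R} (hdet : α.det = 1) (h00 : α 0 0 = 1 + a * u)
    (h01 : α 0 1 = b * u) (hs : a + n * (b + m * (1 + a * u)) = s ^ 2) :
    ∃ β ∈ MLambda R,
      (α * m₁₂ (u * m) * m₂₁ n * m₁₂ (-((b + m * (1 + a * u)) * u)) * β *
          m₁₂ (-(u * n)) * m₂₁ (-m)) 1 0 = b ∧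
      (α * m₁₂ (u * m) * m₂₁ n * m₁₂ (-((b + m * (1 + a * u)) * u)) * β *
          m₁₂ (-(u * n)) * m₂₁ (-m)) 1 1 = 1 + a * u := by
  set N := b + m * (1 + a * u) with hN
  set γ := α * m₁₂ (u * m) * m₂₁ n * m₁₂ (-(N * u)) with hγ
  have hγdet : γ.det = 1 := by
    simp [hγ, hdet, m₁₂, m₂₁, Matrix.det_fin_two_of]
  have hγ00 : γ 0 0 = 1 + s ^ 2 * u := by
    simp [hγ, m₁₂, m₂₁, Matrix.mul_apply, Fin.sum_univ_two, h00, h01]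
    linear_combination u * hs + n * u * hN
  have hγ01 : γ 0 1 = -(N * s ^ 2 * u ^ 2) := by
    simp [hγ, m₁₂, m₂₁, Matrix.mul_apply, Fin.sum_univ_two, h00, h01]
    linear_combination (-N * u ^ 2) * hs - (u - n * N * u ^ 2) * hN
  clear_value γ
  rw [Matrix.det_fin_two, hγ00, hγ01] at hγdet
  have hX : (1 + -(s * γ 1 1 + γ 1 0 * N * s * u) * (s * u)) = γ 1 1 := by
    linear_combination -hγdet
  refine ⟨_, ⟨-(s * γ 1 1 + γ 1 0 * N * s * u), N, -γ 1 0, s, s * u, ?_, rfl⟩, ?_⟩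
  · rw [hX, Matrix.det_fin_two_of]
    linear_combination hγdet
  · rw [hX]
    have hinv : γ * !![γ 1 1, N * (s * u) ^ 2; -γ 1 0, 1 + s * (s * u)] = 1 := by
      ext i j
      fin_cases i <;> fin_cases j <;>
        simp [Matrix.mul_apply, Fin.sum_univ_two, hγ00, hγ01] <;>
        grind
    rw [← Matrix.mul_assoc γ, hinv, Matrix.one_mul]
    simp [m₁₂, m₂₁, Matrix.mul_apply, Fin.sum_univ_two]
    constructor <;> grind

/-- Lemma 3.1: with `A = 𝔽_q[T]` (`q` a power of an odd prime), let `a, b, u ∈ A` and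
let `α ∈ SL₂(A)` have first row `(1 + au, bu)`.  Then there are `m, n ∈ A`, a nonzero
`ε ∈ 𝔽_q`, and `β ∈ M_Λ` such that, with `℘ = b + m(1 + au)`, the matrix
`α · (um)_{12} · n_{21} · (−℘u)_{12} · β · (−ε⁻¹un)_{12} · (−εm)_{21}` has second row
`(εb, 1 + au)`. -/
theorem lemma_first_row_transform
    (F : Type) [Field F] [Fintype F] (hq : Odd (Fintype.card F))
    (a b u : Polynomial F) (α : Matrix (Fin 2) (Fin 2) (Polynomial F))
    (hdet : α.det = 1) (h00 : α 0 0 = 1 + a * u) (h01 : α 0 1 = b * u) :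
    ∃ (m n : Polynomial F) (ε : F), ε ≠ 0 ∧ ∃ β ∈ MLambda (Polynomial F),
      (α * m₁₂ (u * m) * m₂₁ n * m₁₂ (-((b + m * (1 + a * u)) * u)) * β *
          m₁₂ (-(C ε⁻¹ * u * n)) * m₂₁ (-(C ε * m))) 1 0 = C ε * b ∧
      (α * m₁₂ (u * m) * m₂₁ n * m₁₂ (-((b + m * (1 + a * u)) * u)) * β *
          m₁₂ (-(C ε⁻¹ * u * n)) * m₂₁ (-(C ε * m))) 1 1 = 1 + a * u := by
  have h2 : (2 : F) ≠ 0 := by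
    refine Ring.two_ne_zero fun h => ?_
    have := FiniteField.even_card_of_char_two h
    rw [Nat.odd_iff] at hq
    omega
  obtain ⟨m, n, s, hs⟩ : ∃ m n s : F[X], a + n * (b + m * (1 + a * u)) = s ^ 2 := by
    have hdet' := hdet
    rw [Matrix.det_fin_two, h00, h01] at hdet'
    by_cases hv : 1 + a * u = 0
    · refine ⟨0, a * (u * α 1 0), 0, ?_⟩
      linear_combination (-a) * hdet' + a * α 1 1 * hv
    · exact exists_add_mul_eq_sq h2 hv ⟨1, -u, by ring⟩
        ⟨α 1 1, -(u * α 1 0), by linear_combination hdet'⟩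
  refine ⟨m, n, 1, one_ne_zero, ?_⟩
  simpa using exists_mem_MLambda_of_add_mul_eq_sq hdet h00 h01 hs
end
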